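/- arXiv:1203.2723 — 2 statements merged into one kernel-verified Lean document; each statement's English description precedes it below -/
import Mathlib

section
/- For every real ε > 0 there exists n₀ such that for all n ≥ n₀, every simple graph G on n vertices with independence number at most 2 contains at least (3/25 − ε)·C(n,4) cliques of size 4. -/
/-- `G` has no independent set with more than `m` vertices, i.e. α(G) ≤ m. -/
def IndepBound {V : Type*} (G : SimpleGraph V) (m : ℕ) : Prop :=
  ∀ s : Finset V, (∀ u ∈ s, ∀ v ∈ s, u ≠ v → ¬ G.Adj u v) → s.card ≤ m

/-- the number of `k`-cliques (k-element vertex subsets inducing a complete graph) of `G`. -/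
noncomputable def cliqueCount {V : Type*} [Fintype V] (G : SimpleGraph V) (k : ℕ) : ℕ :=
  Nat.card {s : Finset V // s.card = k ∧ G.IsClique (s : Set V)}

/-- A weight on the triangle-free graphs on vertices `r, a, b` rooted at `r`, where `x`, `y`, `z` tell
whether `ra`, `rb`, `ab` are edges. -/
def vertexWeight (c₀₀ c₀₁ c₁₀ c₁₁ c₂₀ : ℤ) (x y z : Bool) : ℤ :=
  bif x then bif y then bif z then 0 else c₂₀ else bif z then c₁₁ else c₁₀
  else bif y then bif z then c₁₁ else c₁₀ else bif z then c₀₁ else c₀₀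

/-- A weight on the possible neighbourhoods of a further vertex in the triple `x, y, z`, where `xy` is
an edge and `a`, `b`, `c` tell whether the vertex is adjacent to `x`, `y`, `z`. -/
def edgeWeight (c₀ c₁ l₀ l₁ r₀ r₁ : ℤ) (a b c : Bool) : ℤ :=
  bif a then bif b then 0 else bif c then l₁ else l₀
  else bif b then bif c then r₁ else r₀ else bif c then c₁ else c₀

/-- The quadratic form in pairs of 3-vertex flags with a common root. -/
def vertexForm (x y z x' y' z' : Bool) : ℤ :=
  let w (c₀₀ c₀₁ c₁₀ c₁₁ c₂₀ : ℤ) : ℤ :=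
    vertexWeight c₀₀ c₀₁ c₁₀ c₁₁ c₂₀ x y z * vertexWeight c₀₀ c₀₁ c₁₀ c₁₁ c₂₀ x' y' z'
  2 * w (-176) (-16) 134 199 (-216) + 840 * w 0 2 (-3) (-7) 16 +
    110 * w 0 4 0 (-1) 0 + 440 * w 0 0 (-2) 1 0

/-- The quadratic form in pairs of 4-vertex flags over the same triple spanning a single edge. -/
def edgeForm (a b c a' b' c' : Bool) : ℤ :=
  let w (c₀ c₁ l₀ l₁ r₀ r₁ : ℤ) : ℤ :=
    edgeWeight c₀ c₁ l₀ l₁ r₀ r₁ a b c * edgeWeight c₀ c₁ l₀ l₁ r₀ r₁ a' b' c'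
  55 * w (-48) 0 (-19) 43 (-19) 43 + 21945 * w 0 0 1 (-1) 1 (-1) + 574200 * w 0 0 1 1 (-1) (-1)

/-- The quadratic form `vertexForm` at the flags `r, a, b` and `r, d, e` of `A`. -/
def vertexTerm {α : Type*} (A : α → α → Bool) (r a b d e : α) : ℤ :=
  vertexForm (A r a) (A r b) (A a b) (A r d) (A r e) (A d e)

/-- The quadratic form `edgeForm` at the vertices `u`, `v`, if the edge `xy` is the only one in the
triple `x, y, z`. -/
def edgeTerm {α : Type*} (A : α → α → Bool) (x y z u v : α) : ℤ :=
  bif A x y && !A x z && !A y z then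
    edgeForm (A x u) (A y u) (A z u) (A x v) (A y v) (A z v) else 0

/-- The indicator of the quadruple `a, b, c, d` spanning no edge of `A`. -/
def indepTerm {α : Type*} (A : α → α → Bool) (a b c d : α) : ℤ :=
  bif A a b || A a c || A a d || A b c || A b d || A c d then 0 else 1

/-- One ordering of five points for each choice of four of them. -/
def quadOrders : List (Fin 5 → Fin 5) := [
  ![1, 2, 3, 4, 0], ![0, 2, 3, 4, 1], ![0, 1, 3, 4, 2], ![0, 1, 2, 4, 3], ![0, 1, 2, 3, 4]]

/-- One ordering of five points for each choice of a point and of a matching of the others. -/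
def vertexOrders : List (Fin 5 → Fin 5) := [
  ![0, 1, 2, 3, 4], ![0, 1, 3, 2, 4], ![0, 1, 4, 2, 3], ![1, 0, 2, 3, 4], ![1, 0, 3, 2, 4],
  ![1, 0, 4, 2, 3], ![2, 0, 1, 3, 4], ![2, 0, 3, 1, 4], ![2, 0, 4, 1, 3], ![3, 0, 1, 2, 4],
  ![3, 0, 2, 1, 4], ![3, 0, 4, 1, 2], ![4, 0, 1, 2, 3], ![4, 0, 2, 1, 3], ![4, 0, 3, 1, 2]]

/-- One ordering of five points for each choice of a pair and of a third point. -/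
def edgeOrders : List (Fin 5 → Fin 5) := [
  ![0, 1, 2, 3, 4], ![0, 1, 3, 2, 4], ![0, 1, 4, 2, 3], ![0, 2, 1, 3, 4], ![0, 2, 3, 1, 4],
  ![0, 2, 4, 1, 3], ![0, 3, 1, 2, 4], ![0, 3, 2, 1, 4], ![0, 3, 4, 1, 2], ![0, 4, 1, 2, 3],
  ![0, 4, 2, 1, 3], ![0, 4, 3, 1, 2], ![1, 2, 0, 3, 4], ![1, 2, 3, 0, 4], ![1, 2, 4, 0, 3],
  ![1, 3, 0, 2, 4], ![1, 3, 2, 0, 4], ![1, 3, 4, 0, 2], ![1, 4, 0, 2, 3], ![1, 4, 2, 0, 3],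
  ![1, 4, 3, 0, 2], ![2, 3, 0, 1, 4], ![2, 3, 1, 0, 4], ![2, 3, 4, 0, 1], ![2, 4, 0, 1, 3],
  ![2, 4, 1, 0, 3], ![2, 4, 3, 0, 1], ![3, 4, 0, 1, 2], ![3, 4, 1, 0, 2], ![3, 4, 2, 0, 1]]

/-- The symmetric irreflexive relation on five points with the given entries. -/
def relOfEntries (a b c d e f g h i j : Bool) : Fin 5 → Fin 5 → Bool :=
  ![![false, a, b, c, d], ![a, false, e, f, g], ![b, e, false, h, i], ![c, f, h, false, j],
  ![d, g, i, j, false]]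

theorem five_point_inequality : ∀ a b c d e f g h i j : Bool,
    (a && b && e || a && c && f || a && d && g || b && c && h || b && d && i || c && d && j ||
      e && f && h || e && g && i || f && g && j || h && i && j) = false →
    253440 +
      2 * (vertexOrders.map fun p ↦
        vertexTerm (relOfEntries a b c d e f g h i j) (p 0) (p 1) (p 2) (p 3) (p 4)).sum +
      (edgeOrders.map fun p ↦
        edgeTerm (relOfEntries a b c d e f g h i j) (p 0) (p 1) (p 2) (p 3) (p 4)).sum ≤
    422400 * (quadOrders.map fun p ↦
        indepTerm (relOfEntries a b c d e f g h i j) (p 0) (p 1) (p 2) (p 3)).sum := by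
  intro a b c d e f g h i j
  simp only [vertexOrders, edgeOrders, quadOrders, relOfEntries, vertexTerm, edgeTerm, indepTerm,
    List.map_cons, List.map_nil, List.sum_cons, List.sum_nil, Matrix.cons_val]
  revert a b c d e f g h i j
  decide +kernel

theorem vertexForm_eq (x y z x' y' z' : Bool) :
    vertexForm x y z x' y' z' =
      2 * (vertexWeight (-176) (-16) 134 199 (-216) x y z *
        vertexWeight (-176) (-16) 134 199 (-216) x' y' z') +
      840 * (vertexWeight 0 2 (-3) (-7) 16 x y z * vertexWeight 0 2 (-3) (-7) 16 x' y' z') +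
      110 * (vertexWeight 0 4 0 (-1) 0 x y z * vertexWeight 0 4 0 (-1) 0 x' y' z') +
      440 * (vertexWeight 0 0 (-2) 1 0 x y z * vertexWeight 0 0 (-2) 1 0 x' y' z') := rfl

theorem edgeForm_eq (a b c a' b' c' : Bool) :
    edgeForm a b c a' b' c' =
      55 * (edgeWeight (-48) 0 (-19) 43 (-19) 43 a b c *
        edgeWeight (-48) 0 (-19) 43 (-19) 43 a' b' c') +
      21945 * (edgeWeight 0 0 1 (-1) 1 (-1) a b c * edgeWeight 0 0 1 (-1) 1 (-1) a' b' c') +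
      574200 * (edgeWeight 0 0 1 1 (-1) (-1) a b c * edgeWeight 0 0 1 1 (-1) (-1) a' b' c') := rfl

theorem sum_sum_mul_nonneg {ι : Type*} [Fintype ι] (f : ι → ℤ) :
    0 ≤ ∑ i, ∑ j, f i * f j := by
  rw [← Finset.sum_mul_sum]
  exact mul_self_nonneg _

theorem sum_vertexTerm_nonneg {V : Type*} [Fintype V] (A : V → V → Bool) :
    0 ≤ ∑ r, ∑ a, ∑ b, ∑ d, ∑ e, vertexTerm A r a b d e := by
  refine Finset.sum_nonneg fun r _ ↦ ?_
  have key (c₀₀ c₀₁ c₁₀ c₁₁ c₂₀ : ℤ) : 0 ≤ ∑ a, ∑ b, ∑ d, ∑ e,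
      vertexWeight c₀₀ c₀₁ c₁₀ c₁₁ c₂₀ (A r a) (A r b) (A a b) *
        vertexWeight c₀₀ c₀₁ c₁₀ c₁₁ c₂₀ (A r d) (A r e) (A d e) := by
    have h := sum_sum_mul_nonneg fun p : V × V ↦
      vertexWeight c₀₀ c₀₁ c₁₀ c₁₁ c₂₀ (A r p.1) (A r p.2) (A p.1 p.2)
    simpa only [Fintype.sum_prod_type] using h
  simp only [vertexTerm, vertexForm_eq, Finset.sum_add_distrib, ← Finset.mul_sum]
  have h₁ := key (-176) (-16) 134 199 (-216)
  have h₂ := key 0 2 (-3) (-7) 16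
  have h₃ := key 0 4 0 (-1) 0
  have h₄ := key 0 0 (-2) 1 0
  simp only [← Finset.mul_sum] at h₁ h₂ h₃ h₄
  linarith

theorem sum_edgeTerm_nonneg {V : Type*} [Fintype V] (A : V → V → Bool) :
    0 ≤ ∑ x, ∑ y, ∑ z, ∑ u, ∑ v, edgeTerm A x y z u v := by
  refine Finset.sum_nonneg fun x _ ↦ Finset.sum_nonneg fun y _ ↦ Finset.sum_nonneg fun z _ ↦ ?_
  unfold edgeTerm
  cases A x y && !A x z && !A y z
  · simp
  have key (c₀ c₁ l₀ l₁ r₀ r₁ : ℤ) : 0 ≤ ∑ u, ∑ v,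
      edgeWeight c₀ c₁ l₀ l₁ r₀ r₁ (A x u) (A y u) (A z u) *
        edgeWeight c₀ c₁ l₀ l₁ r₀ r₁ (A x v) (A y v) (A z v) :=
    sum_sum_mul_nonneg _
  simp only [cond_true, edgeForm_eq, Finset.sum_add_distrib, ← Finset.mul_sum]
  have h₁ := key (-48) 0 (-19) 43 (-19) 43
  have h₂ := key 0 0 1 (-1) 1 (-1)
  have h₃ := key 0 0 1 1 (-1) (-1)
  simp only [← Finset.mul_sum] at h₁ h₂ h₃
  linarith

/-- Functions on `Fin 5` as iterated tuples. -/
def finFiveArrowEquiv (V : Type*) : (Fin 5 → V) ≃ V × V × V × V × V where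
  toFun f := (f 0, f 1, f 2, f 3, f 4)
  invFun p := ![p.1, p.2.1, p.2.2.1, p.2.2.2.1, p.2.2.2.2]
  left_inv f := by
    ext i
    fin_cases i <;> rfl
  right_inv _ := rfl

theorem sum_fin_five_arrow {V : Type*} [Fintype V] (F : V → V → V → V → V → ℤ) :
    ∑ f : Fin 5 → V, F (f 0) (f 1) (f 2) (f 3) (f 4) =
      ∑ a, ∑ b, ∑ c, ∑ d, ∑ e, F a b c d e := by
  refine (Fintype.sum_equiv (finFiveArrowEquiv V) _
    (fun p ↦ F p.1 p.2.1 p.2.2.1 p.2.2.2.1 p.2.2.2.2) fun _ ↦ rfl).trans ?_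
  simp only [Fintype.sum_prod_type]

theorem sum_comp_of_injective {ι V : Type*} [Fintype ι] [DecidableEq ι] [Fintype V]
    (F : (ι → V) → ℤ) {p : ι → ι} (hp : p.Injective) : ∑ f : ι → V, F (f ∘ p) = ∑ f, F f :=
  ((Equiv.ofBijective p (Finite.injective_iff_bijective.mp hp)).symm.arrowCongr
    (Equiv.refl V)).sum_comp F

theorem sum_list_sum_comp {ι V : Type*} [Fintype ι] [DecidableEq ι] [Fintype V]
    (F : (ι → V) → ℤ) (l : List (ι → ι)) (hl : ∀ p ∈ l, p.Injective) :
    ∑ f : ι → V, (l.map fun p ↦ F (f ∘ p)).sum = l.length * ∑ f, F f := by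
  induction l with
  | nil => simp
  | cons p l ih =>
    simp only [List.map_cons, List.sum_cons, List.length_cons, Finset.sum_add_distrib]
    rw [ih fun q hq ↦ hl q (List.mem_cons_of_mem _ hq),
      sum_comp_of_injective F (hl p List.mem_cons_self)]
    push_cast
    ring

theorem five_tuple_inequality {V : Type*} (A : V → V → Bool) (hirr : ∀ a, A a a = false)
    (hsymm : ∀ a b, A a b = A b a) (htri : ∀ a b c, (A a b && A a c && A b c) = false)
    (f : Fin 5 → V) :
    253440 +
      2 * (vertexOrders.map fun p ↦
        vertexTerm A (f (p 0)) (f (p 1)) (f (p 2)) (f (p 3)) (f (p 4))).sum +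
      (edgeOrders.map fun p ↦
        edgeTerm A (f (p 0)) (f (p 1)) (f (p 2)) (f (p 3)) (f (p 4))).sum ≤
    422400 * (quadOrders.map fun p ↦
        indepTerm A (f (p 0)) (f (p 1)) (f (p 2)) (f (p 3))).sum := by
  have h := five_point_inequality (A (f 0) (f 1)) (A (f 0) (f 2)) (A (f 0) (f 3))
    (A (f 0) (f 4)) (A (f 1) (f 2)) (A (f 1) (f 3)) (A (f 1) (f 4)) (A (f 2) (f 3))
    (A (f 2) (f 4)) (A (f 3) (f 4)) (by simp only [htri, Bool.or_false])
  have hrel : ∀ i j, A (f i) (f j) = relOfEntries (A (f 0) (f 1)) (A (f 0) (f 2)) (A (f 0) (f 3))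
      (A (f 0) (f 4)) (A (f 1) (f 2)) (A (f 1) (f 3)) (A (f 1) (f 4)) (A (f 2) (f 3))
      (A (f 2) (f 4)) (A (f 3) (f 4)) i j := by
    intro i j
    fin_cases i <;> fin_cases j <;> first | exact hirr _ | rfl | exact hsymm _ _
  generalize relOfEntries _ _ _ _ _ _ _ _ _ _ = B at h hrel
  simpa only [vertexTerm, edgeTerm, indepTerm, hrel] using h

theorem vertexOrders_injective : ∀ p ∈ vertexOrders, p.Injective := by
  simp [vertexOrders, Function.Injective, Fin.forall_fin_succ]

theorem edgeOrders_injective : ∀ p ∈ edgeOrders, p.Injective := by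
  simp [edgeOrders, Function.Injective, Fin.forall_fin_succ]

theorem quadOrders_injective : ∀ p ∈ quadOrders, p.Injective := by
  simp [quadOrders, Function.Injective, Fin.forall_fin_succ]

/-- A triangle-free relation has at least `3/25 * |V|^4` independent quadruples. -/
theorem three_mul_card_pow_le_sum_indepTerm {V : Type*} [Fintype V] (A : V → V → Bool)
    (hirr : ∀ a, A a a = false) (hsymm : ∀ a b, A a b = A b a)
    (htri : ∀ a b c, (A a b && A a c && A b c) = false) :
    3 * (Fintype.card V : ℤ) ^ 4 ≤ 25 * ∑ a, ∑ b, ∑ c, ∑ d, indepTerm A a b c d := by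
  have h := Finset.sum_le_sum fun (f : Fin 5 → V) (_ : f ∈ Finset.univ) ↦
    five_tuple_inequality A hirr hsymm htri f
  have hv := sum_list_sum_comp
    (fun f : Fin 5 → V ↦ vertexTerm A (f 0) (f 1) (f 2) (f 3) (f 4)) _ vertexOrders_injective
  have he := sum_list_sum_comp
    (fun f : Fin 5 → V ↦ edgeTerm A (f 0) (f 1) (f 2) (f 3) (f 4)) _ edgeOrders_injective
  have hq := sum_list_sum_comp
    (fun f : Fin 5 → V ↦ indepTerm A (f 0) (f 1) (f 2) (f 3)) _ quadOrders_injective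
  simp only [Function.comp_apply] at hv he hq
  simp only [Finset.sum_add_distrib, ← Finset.mul_sum, hv, he, hq] at h
  rw [sum_fin_five_arrow (vertexTerm A), sum_fin_five_arrow (edgeTerm A),
    sum_fin_five_arrow fun a b c d _ ↦ indepTerm A a b c d] at h
  have hv₀ := sum_vertexTerm_nonneg A
  have he₀ := sum_edgeTerm_nonneg A
  simp only [show vertexOrders.length = 15 from rfl, show edgeOrders.length = 30 from rfl,
    show quadOrders.length = 5 from rfl, Finset.sum_const, Finset.card_univ,
    Fintype.card_fun, Fintype.card_fin, nsmul_eq_mul, ← Finset.mul_sum] at h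
  push_cast at h
  rcases Nat.eq_zero_or_pos (Fintype.card V) with h₀ | h₀
  · have := Fintype.card_eq_zero_iff.mp h₀
    simp
  · have hpos : (0 : ℤ) < Fintype.card V := by exact_mod_cast h₀
    refine le_of_mul_le_mul_left ?_ hpos
    linarith

open Finset in
/-- The ordered injective quadruples spanning a clique number at most `4!` per clique. -/
theorem card_injective_clique_le {V : Type*} [Fintype V] (G : SimpleGraph V)
    [DecidablePred fun f : Fin 4 → V ↦ f.Injective ∧ G.IsClique (Set.range f)] :
    #{f : Fin 4 → V | f.Injective ∧ G.IsClique (Set.range f)} ≤ 24 * cliqueCount G 4 := by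
  classical
  have hc : cliqueCount G 4 = #{s : Finset V | s.card = 4 ∧ G.IsClique (s : Set V)} := by
    rw [cliqueCount, Nat.card_eq_fintype_card, Fintype.card_subtype]
  rw [hc]
  refine card_le_mul_card_image_of_maps_to (f := fun f ↦ univ.image f) (fun f hf ↦ ?_) 24
    fun s hs ↦ ?_
  · simp only [mem_filter, mem_univ, true_and] at hf ⊢
    rw [card_image_of_injective _ hf.1]
    simpa using hf.2
  · simp only [mem_filter, mem_univ, true_and] at hs
    have : Fintype.card (Fin 4 ↪ s) = 24 := by
      simp [Fintype.card_embedding_eq, hs.1, Nat.descFactorial]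
    rw [← this, ← card_univ]
    refine card_le_card_of_surjOn (fun e i ↦ (e i : V)) fun f hf ↦ ?_
    simp only [coe_filter, mem_filter, mem_univ, true_and, Set.mem_ofPred_eq] at hf
    have hmem (i : Fin 4) : f i ∈ s := hf.2 ▸ mem_image_of_mem f (mem_univ i)
    exact ⟨⟨fun i ↦ ⟨f i, hmem i⟩, fun i j h ↦ hf.1.1 (congrArg Subtype.val h)⟩, by simp, rfl⟩

/-- Functions on `Fin 4` as iterated tuples. -/
def finFourArrowEquiv (V : Type*) : (Fin 4 → V) ≃ V × V × V × V where
  toFun f := (f 0, f 1, f 2, f 3)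
  invFun p := ![p.1, p.2.1, p.2.2.1, p.2.2.2]
  left_inv f := by
    ext i
    fin_cases i <;> rfl
  right_inv _ := rfl

open Finset in
theorem card_filter_not_injective {ι V : Type*} [Fintype ι] [DecidableEq ι] [Fintype V]
    [DecidableEq V] :
    (#{f : ι → V | ¬ f.Injective} : ℤ) =
      (Fintype.card V : ℤ) ^ Fintype.card ι - (Fintype.card V).descFactorial (Fintype.card ι) := by
  have h := card_filter_add_card_filter_not (s := (univ : Finset (ι → V))) fun f ↦ f.Injective
  have h' : #{f : ι → V | f.Injective} = (Fintype.card V).descFactorial (Fintype.card ι) := by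
    rw [← Fintype.card_embedding_eq, ← Fintype.card_subtype]
    exact Fintype.card_congr (Equiv.subtypeInjectiveEquivEmbedding ι V)
  rw [h', card_univ, Fintype.card_fun] at h
  rw [eq_sub_iff_add_eq', ← Nat.cast_add, h]
  push_cast
  rfl

open Finset Classical in
/-- Almost every quadruple independent in the complement is an ordered clique of the graph. -/
theorem sum_indepTerm_compl_le {V : Type*} [Fintype V] (G : SimpleGraph V) :
    ∑ a, ∑ b, ∑ c, ∑ d, indepTerm (fun x y ↦ decide (Gᶜ.Adj x y)) a b c d ≤
      24 * cliqueCount G 4 + ((Fintype.card V : ℤ) ^ 4 - (Fintype.card V).descFactorial 4) := by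
  have hsum : ∑ f : Fin 4 → V, indepTerm (fun x y ↦ decide (Gᶜ.Adj x y)) (f 0) (f 1) (f 2) (f 3) =
      ∑ a, ∑ b, ∑ c, ∑ d, indepTerm (fun x y ↦ decide (Gᶜ.Adj x y)) a b c d := by
    refine (Fintype.sum_equiv (finFourArrowEquiv V) _
      (fun p ↦ indepTerm (fun x y ↦ decide (Gᶜ.Adj x y)) p.1 p.2.1 p.2.2.1 p.2.2.2)
      fun _ ↦ rfl).trans ?_
    simp only [Fintype.sum_prod_type]
  have hle (f : Fin 4 → V) :
      indepTerm (fun x y ↦ decide (Gᶜ.Adj x y)) (f 0) (f 1) (f 2) (f 3) ≤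
        (if f.Injective ∧ G.IsClique (Set.range f) then 1 else 0) +
          if ¬ f.Injective then 1 else 0 := by
    by_cases hf : f.Injective
    · by_cases hq : G.IsClique (Set.range f)
      · unfold indepTerm
        simp only [hf, hq, Bool.cond_eq_ite]
        split_ifs <;> simp_all
      · suffices ∃ i j, i < j ∧ Gᶜ.Adj (f i) (f j) by
          obtain ⟨i, j, hij, h⟩ := this
          unfold indepTerm
          fin_cases i <;> fin_cases j <;> simp_all
        by_contra! hno
        refine hq ?_
        rintro _ ⟨i, rfl⟩ _ ⟨j, rfl⟩ hne
        by_contra hadj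
        rcases lt_trichotomy i j with h | h | h
        · exact hno i j h ⟨hne, hadj⟩
        · exact hne (congrArg f h)
        · exact hno j i h ⟨hne.symm, fun h' ↦ hadj h'.symm⟩
    · unfold indepTerm
      simp only [hf, Bool.cond_eq_ite]
      split_ifs <;> simp_all
  have h := Finset.sum_le_sum fun (f : Fin 4 → V) (_ : f ∈ Finset.univ) ↦ hle f
  rw [hsum, sum_add_distrib, sum_boole, sum_boole, card_filter_not_injective] at h
  have hc : ((#{f : Fin 4 → V | f.Injective ∧ G.IsClique (Set.range f)} : ℕ) : ℤ) ≤
      24 * cliqueCount G 4 := by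
    exact_mod_cast card_injective_clique_le G
  simp only [Fintype.card_fin] at h
  linarith

theorem IndepBound.not_triangle_compl {V : Type*} {G : SimpleGraph V} (hG : IndepBound G 2)
    {a b c : V} (hab : Gᶜ.Adj a b) (hac : Gᶜ.Adj a c) : ¬ Gᶜ.Adj b c := by
  classical
  intro hbc
  rw [SimpleGraph.compl_adj] at hab hac hbc
  have h := hG {a, b, c} (by
    intro u hu v hv _
    simp only [Finset.mem_insert, Finset.mem_singleton] at hu hv
    have := G.adj_comm a b
    have := G.adj_comm a c
    have := G.adj_comm b c
    rcases hu with rfl | rfl | rfl <;> rcases hv with rfl | rfl | rfl <;> simp_all)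
  rw [Finset.card_eq_three.mpr ⟨a, b, c, hab.1, hac.1, hbc.1, rfl⟩] at h
  omega

theorem IndepBound.three_mul_descFactorial_le {V : Type*} [Fintype V] {G : SimpleGraph V}
    (hG : IndepBound G 2) :
    3 * (Fintype.card V : ℤ) ^ 4 ≤
      25 * (24 * cliqueCount G 4 +
        ((Fintype.card V : ℤ) ^ 4 - (Fintype.card V).descFactorial 4)) := by
  classical
  refine (three_mul_card_pow_le_sum_indepTerm (fun x y ↦ decide (Gᶜ.Adj x y)) (by simp)
    (fun a b ↦ by simp only [Gᶜ.adj_comm a b]) fun a b c ↦ ?_).trans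
    (mul_le_mul_of_nonneg_left (sum_indepTerm_compl_le G) (by norm_num))
  by_contra h
  simp only [Bool.not_eq_false, Bool.and_eq_true, decide_eq_true_eq] at h
  exact hG.not_triangle_compl h.1.1 h.1.2 h.2

theorem pow_four_sub_descFactorial_le {ε : ℝ} (hε : 0 < ε) {n : ℕ} (hn₆ : 6 ≤ n)
    (hn : 96 / ε ≤ n) : (n : ℝ) ^ 4 - n.descFactorial 4 ≤ ε * n.descFactorial 4 := by
  obtain ⟨m, rfl⟩ := Nat.exists_eq_add_of_le hn₆
  have hD : (((6 + m).descFactorial 4 : ℕ) : ℝ) = (m + 6) * (m + 5) * (m + 4) * (m + 3) := by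
    simp only [Nat.descFactorial, show 6 + m - 3 = m + 3 by omega, show 6 + m - 2 = m + 4 by omega,
      show 6 + m - 1 = m + 5 by omega,
      Nat.sub_zero]
    push_cast
    ring
  rw [div_le_iff₀ hε] at hn
  rw [hD]
  push_cast at hn ⊢
  have hm : (0 : ℝ) ≤ m := m.cast_nonneg
  have h₁ : (6 + m : ℝ) ^ 4 - (m + 6) * (m + 5) * (m + 4) * (m + 3) ≤ 6 * (6 + m) ^ 3 := by
    nlinarith [pow_nonneg hm 2, pow_nonneg hm 3]
  have h₂ : (6 + m : ℝ) ^ 4 ≤ 16 * ((m + 6) * (m + 5) * (m + 4) * (m + 3)) := by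
    nlinarith [pow_nonneg hm 2, pow_nonneg hm 3, pow_nonneg hm 4]
  have h₃ := mul_le_mul_of_nonneg_right hn (by positivity : (0 : ℝ) ≤ (6 + m) ^ 3)
  have h₄ := mul_le_mul_of_nonneg_left h₂ hε.le
  linarith

/-- For every real ε > 0 there exists n₀ such that for all n ≥ n₀, every simple graph G
on n vertices with independence number at most 2 contains at least
(3/25 − ε)·C(n,4) cliques of size 4. -/
theorem erdos_43_asymptotic :
    ∀ ε : ℝ, 0 < ε → ∃ n₀ : ℕ, ∀ n : ℕ, n₀ ≤ n →
      ∀ G : SimpleGraph (Fin n), IndepBound G 2 →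
        ((3 : ℝ)/25 - ε) * (n.choose 4) ≤ (cliqueCount G 4 : ℝ) := by
  intro ε hε
  refine ⟨max 6 ⌈96 / ε⌉₊, fun n hn G hG ↦ ?_⟩
  have hn₆ : 6 ≤ n := (le_max_left _ _).trans hn
  have hnε : 96 / ε ≤ (n : ℝ) := Nat.ceil_le.mp ((le_max_right _ _).trans hn)
  have h₁ := pow_four_sub_descFactorial_le hε hn₆ hnε
  have h₂ : 3 * (n : ℝ) ^ 4 ≤ 25 * (24 * cliqueCount G 4 + ((n : ℝ) ^ 4 - n.descFactorial 4)) := by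
    have h := hG.three_mul_descFactorial_le
    rw [Fintype.card_fin] at h
    exact_mod_cast h
  have h₃ : (n.descFactorial 4 : ℝ) = 24 * n.choose 4 := by
    rw [Nat.descFactorial_eq_factorial_mul_choose]
    norm_num [Nat.factorial]
  have h₄ : (n.descFactorial 4 : ℝ) ≤ (n : ℝ) ^ 4 := by
    exact_mod_cast Nat.descFactorial_le_pow n 4
  rw [h₃] at h₁ h₂ h₄
  linarith
end

section
/- There exists n₀ such that for all n ≥ n₀ the following holds. Define (b₁,...,b₅) by: if n = 5k then (k,k,k,k,k); if n = 5k+1 then (k,k,k+1,k−1,k+1); if n = 5k+2 then (k,k,k+1,k,k+1); if n = 5k+3 then (k+1,k+1,k,k+1,k); if n = 5k+4 then (k+1,k+1,k,k+2,k). Then f(n,4,3) = Σ_{i=1}^{5} C(b_i + b_{i+1}, 4) − Σ_{i=1}^{5} C(b_i, 4), with indices taken modulo 5. -/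
/-- `f(n,k,l)`: the minimum number of `k`-cliques over graphs on `n` vertices with
independence number at most `l − 1`. -/
noncomputable def minCliques (n k l : ℕ) : ℕ :=
  sInf {m | ∃ G : SimpleGraph (Fin n), IndepBound G (l - 1) ∧ cliqueCount G k = m}

/-- The part sizes (b₁,…,b₅) of the extremal blow-up of C₅ on n vertices. -/
def bPart (n : ℕ) : Fin 5 → ℕ :=
  let k := n / 5
  if n % 5 = 0 then ![k, k, k, k, k]
  else if n % 5 = 1 then ![k, k, k + 1, k - 1, k + 1]
  else if n % 5 = 2 then ![k, k, k + 1, k, k + 1]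
  else if n % 5 = 3 then ![k + 1, k + 1, k, k + 1, k]
  else ![k + 1, k + 1, k, k + 2, k]

namespace FlagCert

/-- Integer-valued functions of the ten adjacencies among five vertices `a, b, c, d, e`, listed
in the order `ab, ac, ad, ae, bc, bd, be, cd, ce, de`. -/
abbrev Pattern : Type :=
  Bool → Bool → Bool → Bool → Bool → Bool → Bool → Bool → Bool → Bool → ℤ

namespace Pattern

/-- Exchange the first two vertices. -/
def swapAB (F : Pattern) : Pattern := fun ab ac ad ae bc bd be cd ce de =>
  F ab bc bd be ac ad ae cd ce de

/-- Exchange the second and the third vertex. -/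
def swapBC (F : Pattern) : Pattern := fun ab ac ad ae bc bd be cd ce de =>
  F ac ab ad ae bc cd ce bd be de

/-- Exchange the third and the fourth vertex. -/
def swapCD (F : Pattern) : Pattern := fun ab ac ad ae bc bd be cd ce de =>
  F ab ad ac ae bd bc be cd de ce

/-- Exchange the last two vertices. -/
def swapDE (F : Pattern) : Pattern := fun ab ac ad ae bc bd be cd ce de =>
  F ab ac ae ad bc be bd ce cd de

/-- The sum of a pattern over all relabellings of the five vertices. -/
def symm (F : Pattern) : Pattern :=
  let F₅ := F + (F + (F + (F + F.swapAB).swapBC).swapCD).swapDE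
  let F₄ := F₅ + (F₅ + (F₅ + F₅.swapAB).swapBC).swapCD
  let F₃ := F₄ + (F₄ + F₄.swapAB).swapBC
  F₃ + F₃.swapAB

/-- No triangle among the five vertices. -/
def triangleFree (ab ac ad ae bc bd be cd ce de : Bool) : Bool :=
  !(ab && bc && ac) && !(ab && bd && ad) && !(ab && be && ae) && !(ac && cd && ad) &&
  !(ac && ce && ae) && !(ad && de && ae) && !(bc && cd && bd) && !(bc && ce && be) &&
  !(bd && de && be) && !(cd && de && ce)

/-- A function of two vertices `x`, `y` and a root `r`, given by its values on the five
triangle-free isomorphism types. -/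
def rooted (v₀ v₁ v₂ v₃ v₄ : ℤ) (rx ry xy : Bool) : ℤ :=
  cond rx (cond ry v₄ (cond xy v₃ v₂)) (cond ry (cond xy v₃ v₂) (cond xy v₁ v₀))

/-- A function of the number of neighbours of a vertex among three independent roots. -/
def degWeight (p q r : Bool) : ℤ :=
  cond p (cond q (cond r (-3) (-4)) (cond r (-4) 3)) (cond q (cond r (-4) 3) (cond r 3 2))

def indepFour : Pattern := fun ab ac ad _ bc bd _ cd _ _ =>
  cond (ab || ac || ad || bc || bd || cd) 0 1

def pathFour : Pattern := fun ab ac ad ae bc bd be cd ce de =>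
  cond (ab && bc && cd && !ac && !ad && !bd && !ae && !be && !ce && !de) 1 0

def cycleFive : Pattern := fun ab ac ad ae bc bd be cd ce de =>
  cond (ab && bc && cd && de && ae && !ac && !ad && !bd && !be && !ce) 1 0

def rootSq (v₀ v₁ v₂ v₃ v₄ : ℤ) : Pattern := fun ab ac ad ae bc _ _ _ _ de =>
  rooted v₀ v₁ v₂ v₃ v₄ ab ac bc * rooted v₀ v₁ v₂ v₃ v₄ ad ae de

def emptySq : Pattern := fun ab ac ad ae bc bd be cd ce _ =>
  cond (ab || ac || bc) 0 (degWeight ad bd cd * degWeight ae be ce)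

def edgeSq : Pattern := fun ab ac ad ae bc bd be _ _ _ =>
  cond (ab && !ac && !bc) ((cond ad 1 0 - cond bd 1 0) * (cond ae 1 0 - cond be 1 0)) 0

def certA : Pattern :=
  (624834000:ℤ) • indepFour - (74980080:ℤ) • 1 - (3591:ℤ) • rootSq 348 176 (-301) (-237) 78 -
    (306:ℤ) • rootSq 0 (-386) 151 1197 (-2352)
  - (1624 : ℤ) • rootSq 0 178 (-116) 0 27 - (28532984:ℤ) • rootSq 0 2 (-1) 0 0
  - (937251:ℤ) • rootSq (-4) (-4) 1 1 6 - (24993360:ℤ) • emptySq - (3124170000:ℤ) • edgeSq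
  - (1000000000:ℤ) • pathFour

def certB : Pattern :=
  (3000:ℤ) • indepFour - (361:ℤ) • 1 - (1470:ℤ) • rootSq 1 1 (-1) (-1) 1 -
    (555:ℤ) • rootSq (-1) 1 0 (-1) 3
  - (30 : ℤ) • rootSq 3 (-1) 0 (-2) 0 - (75:ℤ) • emptySq - (13200:ℤ) • edgeSq
  + (5000:ℤ) • cycleFive

theorem certA_symm_nonneg : ∀ ab ac ad ae bc bd be cd ce de : Bool,
    triangleFree ab ac ad ae bc bd be cd ce de = true →
      0 ≤ certA.symm ab ac ad ae bc bd be cd ce de := by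
  decide +kernel

theorem certB_symm_nonneg : ∀ ab ac ad ae bc bd be cd ce de : Bool,
    triangleFree ab ac ad ae bc bd be cd ce de = true →
      0 ≤ certB.symm ab ac ad ae bc bd be cd ce de := by
  decide +kernel

section Total

variable {V : Type*} [Fintype V]

/-- The sum of a pattern over all 5-tuples of vertices (repetitions allowed). -/
def total (r : V → V → Bool) (F : Pattern) : ℤ :=
  ∑ a, ∑ b, ∑ c, ∑ d, ∑ e,
    F (r a b) (r a c) (r a d) (r a e) (r b c) (r b d) (r b e) (r c d) (r c e) (r d e)

variable (r : V → V → Bool)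

theorem total_add (F F' : Pattern) : total r (F + F') = total r F + total r F' := by
  simp only [total, Pi.add_apply, Finset.sum_add_distrib]

theorem total_sub (F F' : Pattern) : total r (F - F') = total r F - total r F' := by
  simp only [total, Pi.sub_apply, Finset.sum_sub_distrib]

theorem total_smul (k : ℤ) (F : Pattern) : total r (k • F) = k * total r F := by
  simp only [total, Pi.smul_apply, smul_eq_mul, Finset.mul_sum]

theorem total_one : total r 1 = (Fintype.card V : ℤ) ^ 5 := by
  simp only [total, Pi.one_apply, Finset.sum_const, Finset.card_univ, nsmul_eq_mul]
  ring

variable {r}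

theorem total_swapAB (hr : ∀ x y, r x y = r y x) (F : Pattern) : total r F.swapAB = total r F := by
  simp only [total, swapAB]
  rw [Finset.sum_comm]
  simp only [hr]

theorem total_swapBC (hr : ∀ x y, r x y = r y x) (F : Pattern) : total r F.swapBC = total r F := by
  simp only [total, swapBC]
  refine Finset.sum_congr rfl fun a _ => ?_
  rw [Finset.sum_comm]
  refine Finset.sum_congr rfl fun b _ => Finset.sum_congr rfl fun c _ => ?_
  rw [hr c b]

theorem total_swapCD (hr : ∀ x y, r x y = r y x) (F : Pattern) : total r F.swapCD = total r F := by
  simp only [total, swapCD]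
  refine Finset.sum_congr rfl fun a _ => Finset.sum_congr rfl fun b _ => ?_
  rw [Finset.sum_comm]
  refine Finset.sum_congr rfl fun c _ => Finset.sum_congr rfl fun d _ => ?_
  rw [hr d c]

theorem total_swapDE (hr : ∀ x y, r x y = r y x) (F : Pattern) : total r F.swapDE = total r F := by
  simp only [total, swapDE]
  refine Finset.sum_congr rfl fun a _ => Finset.sum_congr rfl fun b _ =>
    Finset.sum_congr rfl fun c _ => ?_
  rw [Finset.sum_comm]
  refine Finset.sum_congr rfl fun d _ => Finset.sum_congr rfl fun e _ => ?_
  rw [hr e d]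

theorem total_symm (hr : ∀ x y, r x y = r y x) (F : Pattern) : total r F.symm = 120 * total r F := by
  simp only [symm, total_add, total_swapAB hr, total_swapBC hr, total_swapCD hr, total_swapDE hr]
  ring

theorem total_nonneg_of_symm_nonneg (hr : ∀ x y, r x y = r y x)
    (htri : ∀ x y z, r x y = true → r y z = true → r x z = true → False) (F : Pattern)
    (hF : ∀ ab ac ad ae bc bd be cd ce de : Bool,
      triangleFree ab ac ad ae bc bd be cd ce de = true →
        0 ≤ F.symm ab ac ad ae bc bd be cd ce de) :
    0 ≤ total r F := by
  have h : 0 ≤ total r F.symm := by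
    refine Finset.sum_nonneg fun a _ => Finset.sum_nonneg fun b _ => Finset.sum_nonneg fun c _ =>
      Finset.sum_nonneg fun d _ => Finset.sum_nonneg fun e _ => hF _ _ _ _ _ _ _ _ _ _ ?_
    have key : ∀ x y z, (r x y && r y z && r x z) = false := fun x y z => by
      rw [Bool.eq_false_iff]
      intro h
      simp only [Bool.and_eq_true] at h
      exact htri x y z h.1.1 h.1.2 h.2
    simp [triangleFree, key]
  rw [total_symm hr] at h
  linarith

theorem total_rootSq (v₀ v₁ v₂ v₃ v₄ : ℤ) :
    total r (rootSq v₀ v₁ v₂ v₃ v₄) =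
      ∑ a, (∑ x, ∑ y, rooted v₀ v₁ v₂ v₃ v₄ (r a x) (r a y) (r x y)) ^ 2 := by
  simp only [total, rootSq, ← Finset.mul_sum, ← Finset.sum_mul, sq]

theorem total_rootSq_nonneg (v₀ v₁ v₂ v₃ v₄ : ℤ) : 0 ≤ total r (rootSq v₀ v₁ v₂ v₃ v₄) := by
  rw [total_rootSq]
  exact Finset.sum_nonneg fun a _ => sq_nonneg _

theorem total_emptySq_nonneg : 0 ≤ total r emptySq := by
  simp only [total, emptySq]
  refine Finset.sum_nonneg fun a _ => Finset.sum_nonneg fun b _ => Finset.sum_nonneg fun c _ => ?_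
  cases r a b || r a c || r b c
  · simp only [cond_false, ← Finset.mul_sum, ← Finset.sum_mul]
    exact mul_self_nonneg _
  · simp

theorem total_edgeSq_nonneg : 0 ≤ total r edgeSq := by
  simp only [total, edgeSq]
  refine Finset.sum_nonneg fun a _ => Finset.sum_nonneg fun b _ => Finset.sum_nonneg fun c _ => ?_
  cases r a b && !r a c && !r b c
  · simp
  · simp only [cond_true, ← Finset.mul_sum, ← Finset.sum_mul]
    exact mul_self_nonneg _

/-- The number of neighbours of `a`. -/
def deg (r : V → V → Bool) (a : V) : ℤ := ∑ x, cond (r a x) 1 0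

theorem total_rootSq_deg :
    total r (rootSq (-4) (-4) 1 1 6) =
      4 * (Fintype.card V : ℤ) ^ 2 * ∑ a, (5 * deg r a - 2 * Fintype.card V) ^ 2 := by
  rw [total_rootSq, Finset.mul_sum]
  refine Finset.sum_congr rfl fun a _ => ?_
  have h : ∀ x y, rooted (-4) (-4) 1 1 6 (r a x) (r a y) (r x y) =
      5 * cond (r a x) 1 0 + 5 * cond (r a y) 1 0 - 4 := fun x y => by
    cases r a x <;> cases r a y <;> cases r x y <;> rfl
  simp only [h, Finset.sum_sub_distrib, Finset.sum_add_distrib, ← Finset.mul_sum,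
    Finset.sum_const, Finset.card_univ, nsmul_eq_mul, deg]
  ring

/-- The number of 4-tuples of pairwise nonadjacent vertices (repetitions allowed). -/
def indepTuples (r : V → V → Bool) : ℤ :=
  ∑ a, ∑ b, ∑ c, ∑ d, cond (r a b || r a c || r a d || r b c || r b d || r c d) 0 1

theorem total_indepFour : total r indepFour = Fintype.card V * indepTuples r := by
  simp only [total, indepFour, indepTuples, Finset.sum_const, Finset.card_univ, nsmul_eq_mul,
    Finset.mul_sum]

theorem certA_bound (hr : ∀ x y, r x y = r y x)
    (htri : ∀ x y z, r x y = true → r y z = true → r x z = true → False) :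
    1000000000 * total r pathFour + 3749004 * (Fintype.card V : ℤ) ^ 2 *
        ∑ a, (5 * deg r a - 2 * Fintype.card V) ^ 2 ≤
      624834000 * (Fintype.card V * indepTuples r) - 74980080 * (Fintype.card V : ℤ) ^ 5 := by
  have h := total_nonneg_of_symm_nonneg hr htri _ certA_symm_nonneg
  simp only [certA, total_sub, total_smul, total_one, total_indepFour,
    total_rootSq_deg] at h
  linarith [total_rootSq_nonneg (r := r) 348 176 (-301) (-237) 78,
    total_rootSq_nonneg (r := r) 0 (-386) 151 1197 (-2352),
    total_rootSq_nonneg (r := r) 0 178 (-116) 0 27, total_rootSq_nonneg (r := r) 0 2 (-1) 0 0,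
    total_emptySq_nonneg (r := r), total_edgeSq_nonneg (r := r)]

theorem certB_bound (hr : ∀ x y, r x y = r y x)
    (htri : ∀ x y z, r x y = true → r y z = true → r x z = true → False) :
    361 * (Fintype.card V : ℤ) ^ 5 ≤
      3000 * (Fintype.card V * indepTuples r) + 5000 * total r cycleFive := by
  have h := total_nonneg_of_symm_nonneg hr htri _ certB_symm_nonneg
  simp only [certB, total_add, total_sub, total_smul, total_one, total_indepFour] at h
  linarith [total_rootSq_nonneg (r := r) 1 1 (-1) (-1) 1,
    total_rootSq_nonneg (r := r) (-1) 1 0 (-1) 3, total_rootSq_nonneg (r := r) 3 (-1) 0 (-2) 0,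
    total_emptySq_nonneg (r := r), total_edgeSq_nonneg (r := r)]

end Total

variable {V : Type*} {r : V → V → Bool}

/-- The value is one if `v` has no two nonconsecutive neighbours on the cycle `a, b, c, d, e`, and
zero otherwise. -/
def badFor (va vb vc vd ve : Bool) : ℤ :=
  cond (va && vc || vb && vd || vc && ve || vd && va || ve && vb) 0 1

def cycleAt (r : V → V → Bool) (a b c d e : V) : ℤ :=
  cycleFive (r a b) (r a c) (r a d) (r a e) (r b c) (r b d) (r b e) (r c d) (r c e) (r d e)

def pathAt (r : V → V → Bool) (a b c d e : V) : ℤ :=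
  pathFour (r a b) (r a c) (r a d) (r a e) (r b c) (r b d) (r b e) (r c d) (r c e) (r d e)

theorem cycle_bad_le : ∀ ab ac ad ae bc bd be cd ce de va vb vc vd ve : Bool,
    (triangleFree ab ac ad ae bc bd be cd ce de = true ∧ (ab && va && vb) = false ∧
      (bc && vb && vc) = false ∧ (cd && vc && vd) = false ∧ (de && vd && ve) = false ∧
      (ae && va && ve) = false) →
    cycleFive ab ac ad ae bc bd be cd ce de * badFor va vb vc vd ve ≤
      pathFour ab ac ad va bc bd vb cd vc vd + pathFour bc bd be vb cd ce vc de vd ve +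
      pathFour cd ce ac vc de ad vd ae ve va + pathFour de ad bd vd ae be ve ab va vb +
      pathFour ae be ce ve ab ac va bc vb vc := by
  decide +kernel

theorem cycleAt_mul_badFor_le (hr : ∀ x y, r x y = r y x)
    (htri : ∀ x y z, r x y = true → r y z = true → r x z = true → False) (a b c d e v : V) :
    cycleAt r a b c d e * badFor (r a v) (r b v) (r c v) (r d v) (r e v) ≤
      pathAt r a b c d v + pathAt r b c d e v + pathAt r c d e a v + pathAt r d e a b v +
        pathAt r e a b c v := by
  have key : ∀ x y z, (r x y && r y z && r x z) = false := fun x y z => by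
    rw [Bool.eq_false_iff]
    intro h
    simp only [Bool.and_eq_true] at h
    exact htri x y z h.1.1 h.1.2 h.2
  have key' : ∀ x y z, (r x y && r x z && r y z) = false := fun x y z => by
    rw [Bool.and_right_comm]
    exact key x y z
  have h := cycle_bad_le (r a b) (r a c) (r a d) (r a e) (r b c) (r b d) (r b e) (r c d) (r c e)
    (r d e) (r a v) (r b v) (r c v) (r d v) (r e v) ⟨by simp [triangleFree, key], key' _ _ _,
      key' _ _ _, key' _ _ _, key' _ _ _, key' _ _ _⟩
  simp only [cycleAt, pathAt]
  rwa [hr c a, hr d a, hr d b, hr e a, hr e b, hr e c]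

theorem cycleAt_nonneg (a b c d e : V) : 0 ≤ cycleAt r a b c d e := by
  rw [cycleAt, cycleFive, Bool.cond_eq_ite]
  split_ifs <;> simp

theorem cycleAt_le_one (a b c d e : V) : cycleAt r a b c d e ≤ 1 := by
  rw [cycleAt, cycleFive, Bool.cond_eq_ite]
  split_ifs <;> simp

variable [Fintype V]

theorem sum_rotate (G : V → V → V → V → V → ℤ) :
    ∑ a, ∑ b, ∑ c, ∑ d, ∑ e, G b c d e a = ∑ a, ∑ b, ∑ c, ∑ d, ∑ e, G a b c d e := by
  rw [Finset.sum_comm]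
  refine Finset.sum_congr rfl fun b _ => ?_
  rw [Finset.sum_comm]
  refine Finset.sum_congr rfl fun c _ => ?_
  rw [Finset.sum_comm]
  refine Finset.sum_congr rfl fun d _ => ?_
  rw [Finset.sum_comm]

/-- The number of vertices with no two nonconsecutive neighbours on the cycle. -/
def badCount (r : V → V → Bool) (a b c d e : V) : ℤ :=
  ∑ v, badFor (r a v) (r b v) (r c v) (r d v) (r e v)

/-- Squared deviation of the degree from `2n/5`, scaled. -/
def devSq (r : V → V → Bool) (a : V) : ℤ := (5 * deg r a - 2 * Fintype.card V) ^ 2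

theorem sum_pathAt (r : V → V → Bool) :
    ∑ a : V, ∑ b : V, ∑ c : V, ∑ d : V, ∑ _ : V, ∑ v : V, pathAt r a b c d v +
    ∑ _ : V, ∑ b : V, ∑ c : V, ∑ d : V, ∑ e : V, ∑ v : V, pathAt r b c d e v +
    ∑ a : V, ∑ _ : V, ∑ c : V, ∑ d : V, ∑ e : V, ∑ v : V, pathAt r c d e a v +
    ∑ a : V, ∑ b : V, ∑ _ : V, ∑ d : V, ∑ e : V, ∑ v : V, pathAt r d e a b v +
    ∑ a : V, ∑ b : V, ∑ c : V, ∑ _ : V, ∑ e : V, ∑ v : V, pathAt r e a b c v =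
      5 * (Fintype.card V * total r pathFour) := by
  have h₁ : ∑ _ : V, ∑ b : V, ∑ c : V, ∑ d : V, ∑ e : V, ∑ v : V, pathAt r b c d e v =
      Fintype.card V * total r pathFour := by
    simp only [total, pathAt, Finset.sum_const, Finset.card_univ, nsmul_eq_mul]
  have h₀ := sum_rotate fun a b c d e : V => ∑ v : V, pathAt r a b c d v
  have h₂ := sum_rotate fun a b c d e : V => ∑ v : V, pathAt r b c d e v
  have h₃ := sum_rotate fun a b c d e : V => ∑ v : V, pathAt r c d e a v
  have h₄ := sum_rotate fun a b c d e : V => ∑ v : V, pathAt r d e a b v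
  linarith

theorem sum_cycleAt_mul_badCount_le (hr : ∀ x y, r x y = r y x)
    (htri : ∀ x y z, r x y = true → r y z = true → r x z = true → False) :
    ∑ a, ∑ b, ∑ c, ∑ d, ∑ e, cycleAt r a b c d e * badCount r a b c d e ≤
      5 * (Fintype.card V * total r pathFour) := by
  rw [← sum_pathAt]
  simp only [← Finset.sum_add_distrib, badCount, Finset.mul_sum]
  exact Finset.sum_le_sum fun a _ => Finset.sum_le_sum fun b _ => Finset.sum_le_sum fun c _ =>
    Finset.sum_le_sum fun d _ => Finset.sum_le_sum fun e _ => Finset.sum_le_sum fun v _ =>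
      cycleAt_mul_badFor_le hr htri a b c d e v

theorem sum_cycleAt_mul_devSq_le :
    ∑ a, ∑ b, ∑ c, ∑ d, ∑ e, cycleAt r a b c d e *
      (devSq r a + devSq r b + devSq r c + devSq r d + devSq r e) ≤
      5 * ((Fintype.card V : ℤ) ^ 4 * ∑ a, devSq r a) := by
  have h : ∑ a, ∑ b, ∑ c, ∑ d, ∑ e, (devSq r a + devSq r b + devSq r c + devSq r d + devSq r e) =
      5 * ((Fintype.card V : ℤ) ^ 4 * ∑ a, devSq r a) := by
    simp only [Finset.sum_add_distrib, Finset.sum_const, Finset.card_univ, nsmul_eq_mul,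
      ← Finset.mul_sum]
    ring
  rw [← h]
  refine Finset.sum_le_sum fun a _ => Finset.sum_le_sum fun b _ => Finset.sum_le_sum fun c _ =>
    Finset.sum_le_sum fun d _ => Finset.sum_le_sum fun e _ => ?_
  refine mul_le_of_le_one_left ?_ (cycleAt_le_one a b c d e)
  simp only [devSq]
  positivity

/-- A graph with few independent 4-tuples contains a 5-cycle to which almost all vertices attach
canonically and whose vertices have almost the right degrees. -/
theorem exists_good_cycle (hr : ∀ x y, r x y = r y x)
    (htri : ∀ x y z, r x y = true → r y z = true → r x z = true → False)
    (hn : 1000000 ≤ Fintype.card V)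
    (hi : 25 * indepTuples r ≤ 3 * (Fintype.card V : ℤ) ^ 4 + 500 * (Fintype.card V : ℤ) ^ 3) :
    ∃ a b c d e, cycleAt r a b c d e = 1 ∧
      Fintype.card V * badCount r a b c d e +
        (devSq r a + devSq r b + devSq r c + devSq r d + devSq r e) ≤
        1000000000 * Fintype.card V := by
  have hA := certA_bound hr htri
  have hB := certB_bound hr htri
  have hP := sum_cycleAt_mul_badCount_le hr htri
  have hD := sum_cycleAt_mul_devSq_le (r := r)
  change _ + _ * ∑ a, devSq r a ≤ _ at hA
  have hQ : total r cycleFive = ∑ a, ∑ b, ∑ c, ∑ d, ∑ e, cycleAt r a b c d e := rfl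
  have hD0 : 0 ≤ ∑ a, devSq r a := Finset.sum_nonneg fun a _ => sq_nonneg _
  have hP0 : 0 ≤ total r pathFour := by
    refine Finset.sum_nonneg fun a _ => Finset.sum_nonneg fun b _ => Finset.sum_nonneg fun c _ =>
      Finset.sum_nonneg fun d _ => Finset.sum_nonneg fun e _ => ?_
    rw [pathFour, Bool.cond_eq_ite]
    split_ifs <;> simp
  have hn' : (1000000 : ℤ) ≤ Fintype.card V := by exact_mod_cast hn
  set n : ℤ := ((Fintype.card V : ℕ) : ℤ)
  set D := ∑ a, devSq r a
  set P := total r pathFour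
  set I := indepTuples r
  set Q := total r cycleFive
  by_contra! hcon
  have hlow : 1000000000 * n * Q ≤ n * (∑ a, ∑ b, ∑ c, ∑ d, ∑ e,
      cycleAt r a b c d e * badCount r a b c d e) + ∑ a, ∑ b, ∑ c, ∑ d, ∑ e, cycleAt r a b c d e *
      (devSq r a + devSq r b + devSq r c + devSq r d + devSq r e) := by
    rw [hQ]
    simp only [Finset.mul_sum, ← Finset.sum_add_distrib]
    refine Finset.sum_le_sum fun a _ => Finset.sum_le_sum fun b _ => Finset.sum_le_sum fun c _ =>
      Finset.sum_le_sum fun d _ => Finset.sum_le_sum fun e _ => ?_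
    rcases (cycleAt_nonneg (r := r) a b c d e).eq_or_lt with h | h
    · simp [← h]
    · have h1 : cycleAt r a b c d e = 1 := le_antisymm (cycleAt_le_one a b c d e) h
      have := hcon a b c d e h1
      rw [h1]
      linarith
  have hnI : 25 * (n * I) ≤ 3 * n ^ 5 + 500 * n ^ 4 := by
    have := mul_le_mul_of_nonneg_left hi (by linarith : (0:ℤ) ≤ n)
    linarith
  have h4 : 0 < n ^ 4 := by positivity
  have h5 : 1000000 * n ^ 4 ≤ n ^ 5 := by
    have := mul_le_mul_of_nonneg_right hn' h4.le
    linarith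
  have hn2D : 0 ≤ n ^ 2 * D := by positivity
  have hPb : P ≤ 20 * n ^ 4 := by linarith
  have hDb : n ^ 2 * D ≤ 4000 * n ^ 4 := by linarith
  have hQb : n ^ 5 ≤ 10000 * Q := by linarith
  have e1 : n * (n * P) ≤ 20 * n ^ 6 := by
    have := mul_le_mul_of_nonneg_left hPb (by positivity : (0:ℤ) ≤ n ^ 2)
    linarith
  have e2 : n ^ 4 * D ≤ 4000 * n ^ 6 := by
    have := mul_le_mul_of_nonneg_left hDb (by positivity : (0:ℤ) ≤ n ^ 2)
    linarith
  have e3 : n ^ 6 ≤ 10000 * (n * Q) := by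
    have := mul_le_mul_of_nonneg_left hQb (by linarith : (0:ℤ) ≤ n)
    linarith
  have e4 := mul_le_mul_of_nonneg_left hP (by linarith : (0:ℤ) ≤ n)
  have e6 : 0 < n ^ 6 := by positivity
  linarith
end Pattern
end FlagCert

theorem cast_choose_three (m : ℕ) : 6 * (m.choose 3 : ℤ) = m * (m - 1) * (m - 2) := by
  have h2 : ∀ m : ℕ, 2 * (m.choose 2 : ℤ) = m * (m - 1) := fun m => by
    induction m with
    | zero => simp
    | succ m ih => rw [Nat.choose_succ_succ' m 1]; push_cast; rw [Nat.choose_one_right]; linarith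
  induction m with
  | zero => simp
  | succ m ih => rw [Nat.choose_succ_succ' m 2]; push_cast; linarith [h2 m]

/-- The number of injective 4-tuples from a set of size `m`. -/
def fallFour (m : ℤ) : ℤ := m * (m - 1) * (m - 2) * (m - 3)

theorem cast_choose_four (m : ℕ) : 24 * (m.choose 4 : ℤ) = fallFour m := by
  unfold fallFour
  induction m with
  | zero => simp
  | succ m ih =>
    rw [Nat.choose_succ_succ' m 3]
    push_cast
    linarith [cast_choose_three m]

/-- The number of independent 4-tuples of distinct vertices in the blow-up of a 5-cycle with the
given part sizes. -/
def blowupCount (a b c d e : ℤ) : ℤ :=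
  fallFour (a + b) + fallFour (b + c) + fallFour (c + d) + fallFour (d + e) + fallFour (e + a) -
    (fallFour a + fallFour b + fallFour c + fallFour d + fallFour e)

/-- The quadratic form governing the second-order behaviour of `blowupCount`. -/
def cyclicForm (a b c d e : ℤ) : ℤ :=
  4 * ((a + b) ^ 2 + (b + c) ^ 2 + (c + d) ^ 2 + (d + e) ^ 2 + (e + a) ^ 2) -
    (a ^ 2 + b ^ 2 + c ^ 2 + d ^ 2 + e ^ 2)

theorem blowupCount_eq (k a b c d e : ℤ) :
    blowupCount (k + a) (k + b) (k + c) (k + d) (k + e) =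
      5 * (fallFour (2 * k) - fallFour k) + (a + b + c + d + e) *
        (2 * (4 * (2 * k) ^ 3 - 18 * (2 * k) ^ 2 + 22 * (2 * k) - 6) -
          (4 * k ^ 3 - 18 * k ^ 2 + 22 * k - 6)) +
      6 * k ^ 2 * cyclicForm a b c d e +
      k * (8 * ((a + b) ^ 3 + (b + c) ^ 3 + (c + d) ^ 3 + (d + e) ^ 3 + (e + a) ^ 3) -
        4 * (a ^ 3 + b ^ 3 + c ^ 3 + d ^ 3 + e ^ 3) -
        36 * ((a + b) ^ 2 + (b + c) ^ 2 + (c + d) ^ 2 + (d + e) ^ 2 + (e + a) ^ 2) +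
        18 * (a ^ 2 + b ^ 2 + c ^ 2 + d ^ 2 + e ^ 2)) +
      ((a + b) ^ 4 + (b + c) ^ 4 + (c + d) ^ 4 + (d + e) ^ 4 + (e + a) ^ 4 -
        (a ^ 4 + b ^ 4 + c ^ 4 + d ^ 4 + e ^ 4) -
        6 * ((a + b) ^ 3 + (b + c) ^ 3 + (c + d) ^ 3 + (d + e) ^ 3 + (e + a) ^ 3 -
          (a ^ 3 + b ^ 3 + c ^ 3 + d ^ 3 + e ^ 3)) +
        11 * ((a + b) ^ 2 + (b + c) ^ 2 + (c + d) ^ 2 + (d + e) ^ 2 + (e + a) ^ 2 -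
          (a ^ 2 + b ^ 2 + c ^ 2 + d ^ 2 + e ^ 2))) := by
  unfold blowupCount fallFour cyclicForm
  ring

theorem abs_cube_le {x M : ℤ} (h : |x| ≤ M) : -(M * x ^ 2) ≤ x ^ 3 ∧ x ^ 3 ≤ M * x ^ 2 := by
  obtain ⟨h1, h2⟩ := abs_le.1 h
  constructor <;> nlinarith [sq_nonneg x]

theorem pow_four_le {x M : ℤ} (h : |x| ≤ M) : x ^ 4 ≤ M ^ 2 * x ^ 2 := by
  have : x ^ 2 ≤ M ^ 2 := sq_le_sq' (abs_le.1 h).1 (abs_le.1 h).2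
  nlinarith [sq_nonneg x]

theorem cubic_quartic_bounds {M a b c d e : ℤ} (ha : |a| ≤ M) (hb : |b| ≤ M) (hc : |c| ≤ M)
    (hd : |d| ≤ M) (he : |e| ≤ M) :
    |8 * ((a + b) ^ 3 + (b + c) ^ 3 + (c + d) ^ 3 + (d + e) ^ 3 + (e + a) ^ 3) -
        4 * (a ^ 3 + b ^ 3 + c ^ 3 + d ^ 3 + e ^ 3) -
        36 * ((a + b) ^ 2 + (b + c) ^ 2 + (c + d) ^ 2 + (d + e) ^ 2 + (e + a) ^ 2) +
        18 * (a ^ 2 + b ^ 2 + c ^ 2 + d ^ 2 + e ^ 2)| ≤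
      (68 * M + 162) * (a ^ 2 + b ^ 2 + c ^ 2 + d ^ 2 + e ^ 2) ∧
    |(a + b) ^ 4 + (b + c) ^ 4 + (c + d) ^ 4 + (d + e) ^ 4 + (e + a) ^ 4 -
        (a ^ 4 + b ^ 4 + c ^ 4 + d ^ 4 + e ^ 4) -
        6 * ((a + b) ^ 3 + (b + c) ^ 3 + (c + d) ^ 3 + (d + e) ^ 3 + (e + a) ^ 3 -
          (a ^ 3 + b ^ 3 + c ^ 3 + d ^ 3 + e ^ 3)) +
        11 * ((a + b) ^ 2 + (b + c) ^ 2 + (c + d) ^ 2 + (d + e) ^ 2 + (e + a) ^ 2 -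
          (a ^ 2 + b ^ 2 + c ^ 2 + d ^ 2 + e ^ 2))| ≤
      (17 * M ^ 2 + 54 * M + 55) * (a ^ 2 + b ^ 2 + c ^ 2 + d ^ 2 + e ^ 2) := by
  have hM : 0 ≤ M := (abs_nonneg a).trans ha
  have hs : ∀ x y : ℤ, |x| ≤ M → |y| ≤ M →
      0 ≤ (x + y) ^ 2 ∧ (x + y) ^ 2 ≤ 2 * (x ^ 2 + y ^ 2) ∧
      -(4 * M * (x ^ 2 + y ^ 2)) ≤ (x + y) ^ 3 ∧ (x + y) ^ 3 ≤ 4 * M * (x ^ 2 + y ^ 2) ∧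
      0 ≤ (x + y) ^ 4 ∧ (x + y) ^ 4 ≤ 8 * M ^ 2 * (x ^ 2 + y ^ 2) := fun x y hx hy => by
    have h : |x + y| ≤ 2 * M := (abs_add_le x y).trans (by linarith)
    have h2 : (x + y) ^ 2 ≤ 2 * (x ^ 2 + y ^ 2) := by nlinarith [sq_nonneg (x - y)]
    have h3 := abs_cube_le h
    have h4 := pow_four_le h
    have h5 := mul_le_mul_of_nonneg_left h2 (by linarith : 0 ≤ 2 * M)
    have h6 := mul_le_mul_of_nonneg_left h2 (by positivity : 0 ≤ (2 * M) ^ 2)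
    exact ⟨sq_nonneg _, h2, by linarith [h3.1], by linarith [h3.2], by positivity, by linarith⟩
  have hy : ∀ x : ℤ, |x| ≤ M → 0 ≤ x ^ 2 ∧ -(M * x ^ 2) ≤ x ^ 3 ∧ x ^ 3 ≤ M * x ^ 2 ∧ 0 ≤ x ^ 4 ∧
      x ^ 4 ≤ M ^ 2 * x ^ 2 := fun x hx =>
    ⟨sq_nonneg _, (abs_cube_le hx).1, (abs_cube_le hx).2, by positivity, pow_four_le hx⟩
  obtain ⟨a1, a2, a3, a4, a5, a6⟩ := hs a b ha hb
  obtain ⟨b1, b2, b3, b4, b5, b6⟩ := hs b c hb hc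
  obtain ⟨c1, c2, c3, c4, c5, c6⟩ := hs c d hc hd
  obtain ⟨d1, d2, d3, d4, d5, d6⟩ := hs d e hd he
  obtain ⟨e1, e2, e3, e4, e5, e6⟩ := hs e a he ha
  obtain ⟨a7, a8, a9, a10, a11⟩ := hy a ha
  obtain ⟨b7, b8, b9, b10, b11⟩ := hy b hb
  obtain ⟨c7, c8, c9, c10, c11⟩ := hy c hc
  obtain ⟨d7, d8, d9, d10, d11⟩ := hy d hd
  obtain ⟨e7, e8, e9, e10, e11⟩ := hy e he
  constructor <;> rw [abs_le] <;> constructor <;> linarith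

theorem cyclicForm_lower (a b c d e : ℤ) :
    29 * (a + b + c + d + e) ^ 2 + 5 * (a ^ 2 + b ^ 2 + c ^ 2 + d ^ 2 + e ^ 2) ≤
      10 * cyclicForm a b c d e := by
  unfold cyclicForm
  nlinarith [sq_nonneg (36 * a + 11 * b - 29 * c - 29 * d + 11 * e),
    sq_nonneg (235 * b + 143 * c - 145 * d - 233 * e), sq_nonneg (26 * c - 5 * d - 21 * e),
    sq_nonneg (d - e)]

theorem blowupCount_le_of_cyclicForm {k a b c d e a' b' c' d' e' : ℤ} (hk : 1000000 ≤ k)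
    (ha : 1000 * |a| ≤ k) (hb : 1000 * |b| ≤ k) (hc : 1000 * |c| ≤ k) (hd : 1000 * |d| ≤ k)
    (he : 1000 * |e| ≤ k) (ha' : |a'| ≤ 2) (hb' : |b'| ≤ 2) (hc' : |c'| ≤ 2) (hd' : |d'| ≤ 2)
    (he' : |e'| ≤ 2) (hsum : a + b + c + d + e = a' + b' + c' + d' + e')
    (hform : 1 + (a ^ 2 + b ^ 2 + c ^ 2 + d ^ 2 + e ^ 2) ≤
      20 * (cyclicForm a b c d e - cyclicForm a' b' c' d' e')) :
    blowupCount (k + a') (k + b') (k + c') (k + d') (k + e') ≤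
      blowupCount (k + a) (k + b) (k + c) (k + d) (k + e) := by
  rw [blowupCount_eq, blowupCount_eq, hsum]
  obtain ⟨M, hM⟩ : ∃ M, M = k / 1000 := ⟨_, rfl⟩
  have hMk : 1000 * M ≤ k := by omega
  have hM0 : 0 ≤ M := by omega
  obtain ⟨h1, h2⟩ := cubic_quartic_bounds (M := M) (a := a) (b := b) (c := c) (d := d) (e := e)
    (by omega) (by omega) (by omega) (by omega) (by omega)
  obtain ⟨h3, h4⟩ := cubic_quartic_bounds ha' hb' hc' hd' he'
  have hY' : a' ^ 2 + b' ^ 2 + c' ^ 2 + d' ^ 2 + e' ^ 2 ≤ 20 := by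
    have hsq : ∀ x : ℤ, |x| ≤ 2 → x ^ 2 ≤ 4 := fun x hx => by
      have := sq_le_sq' (abs_le.1 hx).1 (abs_le.1 hx).2
      linarith
    linarith [hsq _ ha', hsq _ hb', hsq _ hc', hsq _ hd', hsq _ he']
  have hY : 0 ≤ a ^ 2 + b ^ 2 + c ^ 2 + d ^ 2 + e ^ 2 := by positivity
  have h1' := (abs_le.1 h1).1
  have h2' := (abs_le.1 h2).1
  have h3' := (abs_le.1 h3).2
  have h4' := (abs_le.1 h4).2
  clear h1 h2 h3 h4 ha hb hc hd he ha' hb' hc' hd' he' hM hsum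
  generalize a ^ 2 + b ^ 2 + c ^ 2 + d ^ 2 + e ^ 2 = Y at *
  generalize a' ^ 2 + b' ^ 2 + c' ^ 2 + d' ^ 2 + e' ^ 2 = Y' at *
  generalize 8 * ((a + b) ^ 3 + (b + c) ^ 3 + (c + d) ^ 3 + (d + e) ^ 3 + (e + a) ^ 3) -
        4 * (a ^ 3 + b ^ 3 + c ^ 3 + d ^ 3 + e ^ 3) -
        36 * ((a + b) ^ 2 + (b + c) ^ 2 + (c + d) ^ 2 + (d + e) ^ 2 + (e + a) ^ 2) +
        18 * Y = A at *
  generalize 8 * ((a' + b') ^ 3 + (b' + c') ^ 3 + (c' + d') ^ 3 + (d' + e') ^ 3 + (e' + a') ^ 3) -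
        4 * (a' ^ 3 + b' ^ 3 + c' ^ 3 + d' ^ 3 + e' ^ 3) -
        36 * ((a' + b') ^ 2 + (b' + c') ^ 2 + (c' + d') ^ 2 + (d' + e') ^ 2 + (e' + a') ^ 2) +
        18 * Y' = A' at *
  generalize (a + b) ^ 4 + (b + c) ^ 4 + (c + d) ^ 4 + (d + e) ^ 4 + (e + a) ^ 4 -
        (a ^ 4 + b ^ 4 + c ^ 4 + d ^ 4 + e ^ 4) -
        6 * ((a + b) ^ 3 + (b + c) ^ 3 + (c + d) ^ 3 + (d + e) ^ 3 + (e + a) ^ 3 -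
          (a ^ 3 + b ^ 3 + c ^ 3 + d ^ 3 + e ^ 3)) +
        11 * ((a + b) ^ 2 + (b + c) ^ 2 + (c + d) ^ 2 + (d + e) ^ 2 + (e + a) ^ 2 - Y) = B at *
  generalize (a' + b') ^ 4 + (b' + c') ^ 4 + (c' + d') ^ 4 + (d' + e') ^ 4 + (e' + a') ^ 4 -
        (a' ^ 4 + b' ^ 4 + c' ^ 4 + d' ^ 4 + e' ^ 4) -
        6 * ((a' + b') ^ 3 + (b' + c') ^ 3 + (c' + d') ^ 3 + (d' + e') ^ 3 + (e' + a') ^ 3 -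
          (a' ^ 3 + b' ^ 3 + c' ^ 3 + d' ^ 3 + e' ^ 3)) +
        11 * ((a' + b') ^ 2 + (b' + c') ^ 2 + (c' + d') ^ 2 + (d' + e') ^ 2 + (e' + a') ^ 2 - Y') =
          B' at *
  generalize cyclicForm a b c d e = E at *
  generalize cyclicForm a' b' c' d' e' = E' at *
  have hk0 : 0 ≤ k := by linarith
  have f1 := mul_le_mul_of_nonneg_left hform (sq_nonneg k)
  have f2 := mul_le_mul_of_nonneg_left h1' hk0
  have f3 := mul_le_mul_of_nonneg_left h3' hk0
  have g1 : 1000 * (k * (M * Y)) ≤ k ^ 2 * Y := by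
    have := mul_le_mul_of_nonneg_left hMk (mul_nonneg hk0 hY)
    linarith
  have g2 : 1000000 * (k * Y) ≤ k ^ 2 * Y := by
    have := mul_le_mul_of_nonneg_left hk (mul_nonneg hk0 hY)
    linarith
  have g3 : 1000 * (M ^ 2 * Y) ≤ k * (M * Y) := by
    have := mul_le_mul_of_nonneg_left hMk (mul_nonneg hM0 hY)
    linarith
  have g4 : 1000 * (M * Y) ≤ k * Y := by
    have := mul_le_mul_of_nonneg_left hMk hY
    linarith
  have g5 : 1000000 * Y ≤ k * Y := mul_le_mul_of_nonneg_right hk hY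
  have g6 : k * Y' ≤ 20 * k := by nlinarith
  have g7 : 1000000 * k ≤ k ^ 2 := by nlinarith
  have g8 : 0 ≤ k ^ 2 * Y := by positivity
  linarith

theorem cyclicForm_small : ∀ a ∈ [-2, -1, 0, 1, 2], ∀ b ∈ [-2, -1, 0, 1, 2],
    ∀ c ∈ [-2, -1, 0, 1, 2], ∀ d ∈ [-2, -1, 0, 1, 2], ∀ e ∈ [-2, -1, 0, 1, (2 : ℤ)],
    ∀ z ∈ [![0, 0, 0, 0, 0], ![0, 0, 1, -1, 1], ![0, 0, 1, 0, 1], ![1, 1, 0, 1, 0],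
      ![1, 1, 0, 2, (0 : ℤ)]],
    a + b + c + d + e = z 0 + z 1 + z 2 + z 3 + z 4 →
    1 + (a ^ 2 + b ^ 2 + c ^ 2 + d ^ 2 + e ^ 2) ≤
      20 * (cyclicForm a b c d e - cyclicForm (z 0) (z 1) (z 2) (z 3) (z 4)) ∨
    ∃ j : Fin 5, a = z j ∧ b = z (j + 1) ∧ c = z (j + 2) ∧ d = z (j + 3) ∧ e = z (j + 4) := by
  decide +kernel

theorem blowupCount_offset_le (n : ℕ) (hn : 10000000 ≤ n) (z : Fin 5 → ℤ) (b : Fin 5 → ℕ)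
    (hz : z ∈ [![0, 0, 0, 0, 0], ![0, 0, 1, -1, 1], ![0, 0, 1, 0, 1], ![1, 1, 0, 1, 0],
      ![1, 1, 0, 2, (0 : ℤ)]])
    (hzs : z 0 + z 1 + z 2 + z 3 + z 4 = (n % 5 : ℕ))
    (hb : b 0 + b 1 + b 2 + b 3 + b 4 = n)
    (hclose : ∀ i, 1000 * |(b i : ℤ) - (n / 5 : ℕ)| ≤ (n / 5 : ℕ)) :
    blowupCount ((n / 5 : ℕ) + z 0) ((n / 5 : ℕ) + z 1) ((n / 5 : ℕ) + z 2) ((n / 5 : ℕ) + z 3)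
      ((n / 5 : ℕ) + z 4) ≤ blowupCount (b 0) (b 1) (b 2) (b 3) (b 4) := by
  have hk : (1000000 : ℤ) ≤ (n / 5 : ℕ) := by omega
  obtain ⟨k, hkn⟩ : ∃ k : ℤ, k = (n / 5 : ℕ) := ⟨_, rfl⟩
  have hsum : ((b 0 : ℤ) - k) + (b 1 - k) + (b 2 - k) + (b 3 - k) + (b 4 - k) =
      z 0 + z 1 + z 2 + z 3 + z 4 := by omega
  rw [← hkn] at hclose hk ⊢
  have hz2 : ∀ i, |z i| ≤ 2 := by
    have : ∀ z ∈ [![0, 0, 0, 0, 0], ![0, 0, 1, -1, 1], ![0, 0, 1, 0, 1], ![1, 1, 0, 1, 0],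
      ![1, 1, 0, 2, (0 : ℤ)]], ∀ i : Fin 5, |z i| ≤ 2 := by decide
    exact this z hz
  have hbk : ∀ i, ∃ y : ℤ, (b i : ℤ) = k + y ∧ 1000 * |y| ≤ k := fun i =>
    ⟨b i - k, by ring, hclose i⟩
  choose y hy hyk using hbk
  simp only [hy, add_sub_cancel_left] at hsum ⊢
  have hform : 1 + (y 0 ^ 2 + y 1 ^ 2 + y 2 ^ 2 + y 3 ^ 2 + y 4 ^ 2) ≤
      20 * (cyclicForm (y 0) (y 1) (y 2) (y 3) (y 4) -
        cyclicForm (z 0) (z 1) (z 2) (z 3) (z 4)) ∨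
      ∃ j : Fin 5, y 0 = z j ∧ y 1 = z (j + 1) ∧ y 2 = z (j + 2) ∧ y 3 = z (j + 3) ∧
        y 4 = z (j + 4) := by
    by_cases hY : y 0 ^ 2 + y 1 ^ 2 + y 2 ^ 2 + y 3 ^ 2 + y 4 ^ 2 ≤ 8
    · have hmem : ∀ x : ℤ, x ^ 2 ≤ 8 → x ∈ [-2, -1, 0, 1, (2 : ℤ)] := fun x hx => by
        have h1 : -3 < x := by nlinarith
        have h2 : x < 3 := by nlinarith
        simp only [List.mem_cons, List.not_mem_nil, or_false]
        omega
      refine cyclicForm_small _ (hmem _ ?_) _ (hmem _ ?_) _ (hmem _ ?_) _ (hmem _ ?_) _ (hmem _ ?_)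
        z hz hsum <;>
      linarith [sq_nonneg (y 0), sq_nonneg (y 1), sq_nonneg (y 2), sq_nonneg (y 3),
        sq_nonneg (y 4)]
    · left
      have h1 := cyclicForm_lower (y 0) (y 1) (y 2) (y 3) (y 4)
      rw [hsum] at h1
      have h2 : ∀ z ∈ [![0, 0, 0, 0, 0], ![0, 0, 1, -1, 1], ![0, 0, 1, 0, 1], ![1, 1, 0, 1, 0],
          ![1, 1, 0, 2, (0 : ℤ)]], 10 * cyclicForm (z 0) (z 1) (z 2) (z 3) (z 4) ≤
          29 * (z 0 + z 1 + z 2 + z 3 + z 4) ^ 2 + 36 := by decide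
      have h3 := h2 z hz
      linarith
  rcases hform with h | ⟨j, h0, h1, h2, h3, h4⟩
  · exact blowupCount_le_of_cyclicForm hk (hyk 0) (hyk 1) (hyk 2) (hyk 3) (hyk 4) (hz2 0) (hz2 1)
      (hz2 2) (hz2 3) (hz2 4) hsum h
  · rw [h0, h1, h2, h3, h4]
    apply le_of_eq
    fin_cases j <;> simp [blowupCount] <;> ring

/-- The extremal part sizes are small perturbations of `n / 5`. -/
theorem bPart_eq_offset (n : ℕ) (hn : 5 ≤ n) :
    ∃ z ∈ [![0, 0, 0, 0, 0], ![0, 0, 1, -1, 1], ![0, 0, 1, 0, 1], ![1, 1, 0, 1, 0],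
      ![1, 1, 0, 2, (0 : ℤ)]], z 0 + z 1 + z 2 + z 3 + z 4 = (n % 5 : ℕ) ∧
      ∀ i, (bPart n i : ℤ) = (n / 5 : ℕ) + z i := by
  have hk : 1 ≤ n / 5 := by omega
  have h5 : n % 5 < 5 := Nat.mod_lt _ (by norm_num)
  unfold bPart
  generalize n / 5 = k at *
  generalize n % 5 = r at *
  interval_cases r
  · refine ⟨![0, 0, 0, 0, 0], by simp, by simp, fun i => ?_⟩
    fin_cases i <;> simp
  · refine ⟨![0, 0, 1, -1, 1], by simp, by simp, fun i => ?_⟩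
    fin_cases i <;> simp
    omega
  · refine ⟨![0, 0, 1, 0, 1], by simp, by simp, fun i => ?_⟩
    fin_cases i <;> simp
  · refine ⟨![1, 1, 0, 1, 0], by simp, by simp, fun i => ?_⟩
    fin_cases i <;> simp
  · refine ⟨![1, 1, 0, 2, 0], by simp, by simp, fun i => ?_⟩
    fin_cases i <;> simp

theorem sum_bPart (n : ℕ) (hn : 5 ≤ n) :
    bPart n 0 + bPart n 1 + bPart n 2 + bPart n 3 + bPart n 4 = n := by
  obtain ⟨z, -, hs, hb⟩ := bPart_eq_offset n hn
  have h0 := hb 0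
  have h1 := hb 1
  have h2 := hb 2
  have h3 := hb 3
  have h4 := hb 4
  omega

theorem blowupCount_bPart_le (n : ℕ) (hn : 10000000 ≤ n) (b : Fin 5 → ℕ)
    (hb : b 0 + b 1 + b 2 + b 3 + b 4 = n)
    (hclose : ∀ i, 1000 * |(b i : ℤ) - (n / 5 : ℕ)| ≤ (n / 5 : ℕ)) :
    blowupCount (bPart n 0) (bPart n 1) (bPart n 2) (bPart n 3) (bPart n 4) ≤
      blowupCount (b 0) (b 1) (b 2) (b 3) (b 4) := by
  obtain ⟨z, hz, hs, hbz⟩ := bPart_eq_offset n (by omega)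
  simp only [hbz]
  exact blowupCount_offset_le n hn z b hz hs hb hclose

theorem blowupCount_bPart_upper (n : ℕ) (hn : 10000000 ≤ n) :
    25 * blowupCount (bPart n 0) (bPart n 1) (bPart n 2) (bPart n 3) (bPart n 4) ≤
      3 * (n : ℤ) ^ 4 + 300 * n ^ 3 := by
  obtain ⟨z, hz, hs, hbz⟩ := bPart_eq_offset n (by omega)
  simp only [hbz]
  have hk : (1000000 : ℤ) ≤ (n / 5 : ℕ) := by omega
  have hnk : (n : ℤ) = 5 * (n / 5 : ℕ) + (z 0 + z 1 + z 2 + z 3 + z 4) := by omega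
  rw [hnk]
  generalize ((n / 5 : ℕ) : ℤ) = k at *
  obtain ⟨t, rfl⟩ : ∃ t, k = 1000000 + t := ⟨k - 1000000, by ring⟩
  have ht : 0 ≤ t := by linarith
  have h2 : 0 ≤ t ^ 2 := by positivity
  have h3 : 0 ≤ t ^ 3 := by positivity
  have h4 : 0 ≤ t ^ 4 := by positivity
  simp only [List.mem_cons, List.not_mem_nil, or_false] at hz
  rcases hz with rfl | rfl | rfl | rfl | rfl <;> simp [blowupCount, fallFour] <;> linarith

/-- The number of 4-cliques in the extremal graph on `n` vertices. -/
def extremalValue (n : ℕ) : ℕ :=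
  (∑ i : Fin 5, (bPart n i + bPart n (i + 1)).choose 4) - ∑ i : Fin 5, (bPart n i).choose 4

theorem blowupCount_cast (b : Fin 5 → ℕ) :
    blowupCount (b 0) (b 1) (b 2) (b 3) (b 4) =
      24 * ((∑ i : Fin 5, (b i + b (i + 1)).choose 4 : ℕ) - (∑ i : Fin 5, (b i).choose 4 : ℕ) : ℤ)
    := by
  have h := fun m : ℕ => cast_choose_four m
  simp only [Fin.sum_univ_five, Nat.cast_add, mul_sub, mul_add, h, Fin.isValue]
  simp [blowupCount]

theorem sum_choose_le (b : Fin 5 → ℕ) :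
    ∑ i : Fin 5, (b i).choose 4 ≤ ∑ i : Fin 5, (b i + b (i + 1)).choose 4 :=
  Finset.sum_le_sum fun _ _ => Nat.choose_le_choose 4 (Nat.le_add_right _ _)

theorem blowupCount_bPart (n : ℕ) :
    blowupCount (bPart n 0) (bPart n 1) (bPart n 2) (bPart n 3) (bPart n 4) =
      24 * (extremalValue n : ℤ) := by
  rw [blowupCount_cast, extremalValue, Nat.cast_sub (sum_choose_le _)]

theorem card_near_indices : ∀ I : Finset (Fin 5), I.Nonempty →
    (if ∃ i, ∀ x ∈ I, x = i ∨ x = i + 1 then 1 else 0) +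
        ∑ i, (if ∀ x ∈ I, x = i then 1 else 0) =
      ∑ i, if ∀ x ∈ I, x = i ∨ x = i + 1 then 1 else 0 := by
  decide +kernel

theorem near_of_pairwise : ∀ I : Finset (Fin 5), (∀ x ∈ I, ∀ y ∈ I, y ≠ x + 2) →
    ∃ i, ∀ x ∈ I, x = i ∨ x = i + 1 := by
  decide +kernel

section Near

variable {V : Type*}

theorem card_filter_powersetCard (S : Finset V) (p : V → Prop) [DecidablePred p] (k : ℕ) :
    ((S.powersetCard k).filter fun s => ∀ x ∈ s, p x).card = (S.filter p).card.choose k := by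
  rw [← Finset.card_powersetCard]
  congr 1
  ext s
  simp only [Finset.mem_filter, Finset.mem_powersetCard, Finset.subset_iff]
  constructor
  · rintro ⟨⟨h1, h2⟩, h3⟩
    exact ⟨fun x hx => ⟨h1 hx, h3 x hx⟩, h2⟩
  · rintro ⟨h1, h2⟩
    exact ⟨⟨fun x hx => (h1 hx).1, h2⟩, fun x hx => (h1 hx).2⟩

/-- Inclusion-exclusion for the `k`-sets contained in two cyclically consecutive classes. -/
theorem card_near_sets [DecidableEq V] (S : Finset V) (f : V → Fin 5) {k : ℕ} (hk : k ≠ 0) :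
    ((S.powersetCard k).filter fun s => ∃ i, ∀ x ∈ s, f x = i ∨ f x = i + 1).card +
        ∑ i, (S.filter fun x => f x = i).card.choose k =
      ∑ i, ((S.filter fun x => f x = i).card + (S.filter fun x => f x = i + 1).card).choose k := by
  have h1 : ∀ i : Fin 5, (S.filter fun x => f x = i).card + (S.filter fun x => f x = i + 1).card =
      (S.filter fun x => f x = i ∨ f x = i + 1).card := fun i => by
    rw [Finset.filter_or, Finset.card_union_of_disjoint]
    refine Finset.disjoint_filter.2 fun x _ h h' => ?_
    rw [h] at h'
    revert h'
    clear h
    revert i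
    decide
  simp only [h1, ← card_filter_powersetCard]
  simp only [Finset.card_filter]
  rw [Finset.sum_comm, Finset.sum_comm (s := Finset.univ (α := Fin 5)), ← Finset.sum_add_distrib]
  refine Finset.sum_congr rfl fun s hs => ?_
  have hne : (s.image f).Nonempty := by
    rw [Finset.image_nonempty, ← Finset.card_pos, (Finset.mem_powersetCard.1 hs).2]
    omega
  simpa only [Finset.forall_mem_image] using card_near_indices _ hne

end Near

section Count

variable {V : Type*}

/-- The complement of the balanced blow-up of the 5-cycle. -/
def farGraph (f : V → Fin 5) : SimpleGraph V where
  Adj x y := f y = f x + 2 ∨ f x = f y + 2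
  symm := ⟨fun _ _ h => h.symm⟩
  loopless := ⟨fun x h => by
    have : ∀ a : Fin 5, a ≠ a + 2 := by decide
    exact this (f x) (h.elim id id)⟩

theorem farGraph_triangleFree (f : V → Fin 5) (x y z : V) (hxy : (farGraph f).Adj x y)
    (hyz : (farGraph f).Adj y z) (hxz : (farGraph f).Adj x z) : False := by
  have : ∀ a b c : Fin 5, b = a + 2 ∨ a = b + 2 → c = b + 2 ∨ b = c + 2 →
      c = a + 2 ∨ a = c + 2 → False := by decide
  exact this _ _ _ hxy hyz hxz

theorem indepBound_compl (H : SimpleGraph V) :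
    IndepBound Hᶜ 2 ↔ ∀ x y z, H.Adj x y → H.Adj y z → H.Adj x z → False := by
  classical
  constructor
  · intro h x y z hxy hyz hxz
    have := h {x, y, z} (by
      intro u hu v hv huv
      simp only [Finset.mem_insert, Finset.mem_singleton] at hu hv
      simp only [SimpleGraph.compl_adj, not_and, not_not]
      rcases hu with rfl | rfl | rfl <;> rcases hv with rfl | rfl | rfl <;>
        simp_all [SimpleGraph.adj_comm])
    rw [Finset.card_eq_three.2 ⟨x, y, z, hxy.ne, hxz.ne, hyz.ne, rfl⟩] at this
    omega
  · intro h s hs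
    by_contra! hc
    obtain ⟨x, y, z, hx, hy, hz, hxy, hxz, hyz⟩ := Finset.two_lt_card_iff.1 hc
    have key : ∀ u ∈ s, ∀ v ∈ s, u ≠ v → H.Adj u v := fun u hu v hv huv => by
      have := hs u hu v hv huv
      simpa [huv] using this
    exact h x y z (key x hx y hy hxy) (key y hy z hz hyz) (key x hx z hz hxz)

variable [Fintype V] [DecidableEq V]

open Classical in
/-- The independent sets of size `k`. -/
noncomputable def indepSets (H : SimpleGraph V) (k : ℕ) : Finset (Finset V) :=
  (Finset.univ.powersetCard k).filter fun s => ∀ x ∈ s, ∀ y ∈ s, ¬ H.Adj x y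

theorem mem_indepSets {H : SimpleGraph V} {k : ℕ} {s : Finset V} :
    s ∈ indepSets H k ↔ s.card = k ∧ ∀ x ∈ s, ∀ y ∈ s, ¬ H.Adj x y := by
  simp [indepSets]

theorem cliqueCount_compl (H : SimpleGraph V) (k : ℕ) :
    cliqueCount Hᶜ k = (indepSets H k).card := by
  refine Nat.subtype_card _ fun s => ?_
  rw [mem_indepSets]
  refine and_congr_right fun _ => ⟨fun h x hx y hy hxy => ?_, fun h x hx y hy hxy => ?_⟩
  · exact (SimpleGraph.compl_adj H x y).2 ⟨hxy, h x hx y hy⟩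
  · exact ((SimpleGraph.compl_adj H x y).1 (h hx hy hxy.ne)).2 hxy

/-- A graph whose edges join far classes has many independent sets. -/
theorem blowup_le_card_indepSets (H : SimpleGraph V) (f : V → Fin 5)
    (hf : ∀ x y, H.Adj x y → f y = f x + 2 ∨ f x = f y + 2) {k : ℕ} (hk : k ≠ 0) :
    ∑ i, ((Finset.univ.filter fun x => f x = i).card +
        (Finset.univ.filter fun x => f x = i + 1).card).choose k ≤
      (indepSets H k).card + ∑ i, (Finset.univ.filter fun x => f x = i).card.choose k := by
  rw [← card_near_sets _ _ hk]
  gcongr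
  intro s hs
  simp only [Finset.mem_filter, Finset.mem_powersetCard] at hs
  obtain ⟨⟨-, hc⟩, i, hi⟩ := hs
  refine mem_indepSets.2 ⟨hc, fun x hx y hy hxy => ?_⟩
  have h1 := hf x y hxy
  have h2 := hi x hx
  have h3 := hi y hy
  have : ∀ i a b : Fin 5, b = a + 2 ∨ a = b + 2 → a = i ∨ a = i + 1 → b = i ∨ b = i + 1 → False := by
    decide
  exact this i _ _ h1 h2 h3

theorem card_indepSets_farGraph (f : V → Fin 5) {k : ℕ} (hk : k ≠ 0) :
    (indepSets (farGraph f) k).card + ∑ i, (Finset.univ.filter fun x => f x = i).card.choose k =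
      ∑ i, ((Finset.univ.filter fun x => f x = i).card +
        (Finset.univ.filter fun x => f x = i + 1).card).choose k := by
  refine le_antisymm ?_ (blowup_le_card_indepSets (farGraph f) f (fun _ _ h => h) hk)
  rw [← card_near_sets _ _ hk]
  gcongr
  intro s hs
  rw [mem_indepSets] at hs
  simp only [Finset.mem_filter, Finset.mem_powersetCard, Finset.subset_univ, true_and]
  refine ⟨hs.1, ?_⟩
  have := near_of_pairwise (s.image f) (by
    simp only [Finset.forall_mem_image]
    exact fun x hx y hy h => hs.2 x hx y hy (Or.inl h))
  simpa only [Finset.forall_mem_image] using this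

end Count

theorem exists_fibres (n : ℕ) (b : Fin 5 → ℕ) (hb : b 0 + b 1 + b 2 + b 3 + b 4 = n) :
    ∃ f : Fin n → Fin 5, ∀ i, (Finset.univ.filter fun x => f x = i).card = b i := by
  have hc : Fintype.card (Fin n) = Fintype.card (Σ i : Fin 5, Fin (b i)) := by
    simp [Fin.sum_univ_five, hb]
  let e := Fintype.equivOfCardEq hc
  refine ⟨fun x => (e x).1, fun i => ?_⟩
  symm
  rw [← Fintype.card_fin (b i), ← Finset.card_univ]
  refine Finset.card_bij (fun y _ => e.symm ⟨i, y⟩) (fun y _ => by simp)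
    (fun y _ y' _ h => by simpa using h) fun x hx => ?_
  have hx' : (e x).1 = i := (Finset.mem_filter.1 hx).2
  obtain ⟨y, hy⟩ : ∃ y, e x = y := ⟨_, rfl⟩
  rw [hy] at hx'
  subst hx'
  exact ⟨y.2, Finset.mem_univ _, by rw [Equiv.symm_apply_eq, hy]⟩

theorem exists_extremal_graph (n : ℕ) (hn : 5 ≤ n) :
    ∃ H : SimpleGraph (Fin n), (∀ x y z, H.Adj x y → H.Adj y z → H.Adj x z → False) ∧
      (indepSets H 4).card = extremalValue n := by
  obtain ⟨f, hf⟩ := exists_fibres n (bPart n) (sum_bPart n hn)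
  refine ⟨farGraph f, farGraph_triangleFree f, ?_⟩
  have := card_indepSets_farGraph f (k := 4) (by norm_num)
  simp only [hf] at this
  rw [extremalValue]
  omega

section Cloning

variable {V : Type*} [DecidableEq V]

theorem card_distinct_tuples_le (T : Finset (V × V × V × V)) (C : Finset (Finset V))
    (hT : ∀ t ∈ T, [t.1, t.2.1, t.2.2.1, t.2.2.2].Nodup ∧ {t.1, t.2.1, t.2.2.1, t.2.2.2} ∈ C)
    (hC : ∀ s ∈ C, s.card = 4) :
    T.card ≤ 24 * C.card := by
  refine Finset.card_le_mul_card_image_of_maps_to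
    (f := fun t => ({t.1, t.2.1, t.2.2.1, t.2.2.2} : Finset V)) (fun t ht => (hT t ht).2) 24 ?_
  intro s hs
  calc _ ≤ s.toList.permutations.toFinset.card := by
        refine Finset.card_le_card_of_injOn (fun t => [t.1, t.2.1, t.2.2.1, t.2.2.2]) ?_ ?_
        · intro t ht
          simp only [Finset.coe_filter, Set.mem_ofPred_eq] at ht
          simp only [Finset.mem_coe, List.mem_toFinset, List.mem_permutations]
          refine List.perm_of_nodup_nodup_toFinset_eq (hT t ht.1).1 s.nodup_toList ?_
          rw [Finset.toList_toFinset, ← ht.2]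
          simp
        · rintro ⟨a, b, c, d⟩ _ ⟨a', b', c', d'⟩ _ h
          simpa using h
    _ ≤ s.toList.permutations.length := List.toFinset_card_le _
    _ = 24 := by rw [List.length_permutations, Finset.length_toList, hC s hs]; rfl

variable [Fintype V]

theorem indepTuples_le (H : SimpleGraph V) [DecidableRel H.Adj] :
    FlagCert.Pattern.indepTuples (fun x y => decide (H.Adj x y)) ≤
      24 * ((indepSets H 4).card : ℤ) + 6 * (Fintype.card V : ℤ) ^ 3 := by
  let p : V → V → V → V → Prop := fun a b c d => [a, b, c, d].Nodup ∧ ¬ H.Adj a b ∧ ¬ H.Adj a c ∧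
    ¬ H.Adj a d ∧ ¬ H.Adj b c ∧ ¬ H.Adj b d ∧ ¬ H.Adj c d
  have h1 : ∑ a, ∑ b, ∑ c, ∑ d, (if p a b c d then (1 : ℤ) else 0) ≤
      24 * ((indepSets H 4).card : ℤ) := by
    have := card_distinct_tuples_le
      (Finset.univ.filter fun t : V × V × V × V => p t.1 t.2.1 t.2.2.1 t.2.2.2) (indepSets H 4)
      (fun t ht => ?_) fun s hs => (mem_indepSets.1 hs).1
    · rw [Finset.card_filter] at this
      simp only [Fintype.sum_prod_type] at this
      exact_mod_cast this
    · obtain ⟨hnd, h⟩ := (Finset.mem_filter.1 ht).2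
      refine ⟨hnd, mem_indepSets.2 ⟨?_, ?_⟩⟩
      · have := List.toFinset_card_of_nodup hnd
        simpa using this
      · simp only [Finset.mem_insert, Finset.mem_singleton]
        rintro x (rfl | rfl | rfl | rfl) y (rfl | rfl | rfl | rfl) <;> simp_all [H.adj_comm]
  have h2 : ∑ a : V, ∑ b : V, ∑ c : V, ∑ d : V, ((if a = b then (1 : ℤ) else 0) +
      (if a = c then 1 else 0) + (if a = d then 1 else 0) + (if b = c then 1 else 0) +
      (if b = d then 1 else 0) + (if c = d then 1 else 0)) = 6 * (Fintype.card V : ℤ) ^ 3 := by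
    simp only [Finset.sum_add_distrib, Finset.sum_const, Finset.card_univ, nsmul_eq_mul,
      Finset.sum_ite_eq, Finset.mem_univ, if_true, ← Finset.mul_sum]
    ring
  rw [← h2]
  refine le_trans ?_ (add_le_add_left h1 _)
  simp only [← Finset.sum_add_distrib, FlagCert.Pattern.indepTuples]
  refine Finset.sum_le_sum fun a _ => Finset.sum_le_sum fun b _ => Finset.sum_le_sum fun c _ =>
    Finset.sum_le_sum fun d _ => ?_
  have hite : ∀ q : Prop, ∀ _ : Decidable q, 0 ≤ (if q then (1 : ℤ) else 0) ∧
      (if q then (1 : ℤ) else 0) ≤ 1 := fun q _ => by split_ifs <;> simp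
  have n₀ := hite (p a b c d) inferInstance
  have n₁ := hite (a = b) inferInstance
  have n₂ := hite (a = c) inferInstance
  have n₃ := hite (a = d) inferInstance
  have n₄ := hite (b = c) inferInstance
  have n₅ := hite (b = d) inferInstance
  have n₆ := hite (c = d) inferInstance
  have h01 : ∀ q : Prop, ∀ _ : Decidable q, (if q then (0 : ℤ) else 1) ≤ 1 := fun q _ => by
    split_ifs <;> norm_num
  rw [Bool.cond_eq_ite]
  by_cases hnd : [a, b, c, d].Nodup
  · by_cases hq : p a b c d
    · rw [if_pos hq]
      refine (h01 _ _).trans ?_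
      linarith
    · rw [if_pos]
      · linarith
      · by_contra hcon
        simp only [Bool.or_eq_true, decide_eq_true_eq, not_or] at hcon
        exact hq ⟨hnd, by tauto⟩
  · have hle : 1 ≤ (if a = b then (1 : ℤ) else 0) + (if a = c then 1 else 0) +
        (if a = d then 1 else 0) + (if b = c then 1 else 0) + (if b = d then 1 else 0) +
        (if c = d then 1 else 0) := by
      by_contra! hlt
      refine hnd ?_
      have hne : ∀ q : Prop, ∀ _ : Decidable q, (if q then (1 : ℤ) else 0) < 1 → ¬ q :=
        fun q _ h hq => by simp [hq] at h
      have h₁ : a ≠ b := hne _ inferInstance (by linarith)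
      have h₂ : a ≠ c := hne _ inferInstance (by linarith)
      have h₃ : a ≠ d := hne _ inferInstance (by linarith)
      have h₄ : b ≠ c := hne _ inferInstance (by linarith)
      have h₅ : b ≠ d := hne _ inferInstance (by linarith)
      have h₆ : c ≠ d := hne _ inferInstance (by linarith)
      simp [h₁, h₂, h₃, h₄, h₅, h₆]
    refine (h01 _ _).trans ?_
    linarith

/-- The number of independent 4-sets through a vertex. -/
noncomputable def indepDeg (H : SimpleGraph V) (v : V) : ℕ :=
  ((indepSets H 4).filter fun s => v ∈ s).card

theorem sum_indepDeg (H : SimpleGraph V) : ∑ v, indepDeg H v = 4 * (indepSets H 4).card := by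
  simp only [indepDeg, Finset.card_filter]
  rw [Finset.sum_comm]
  have : ∀ s ∈ indepSets H 4, ∑ v, (if v ∈ s then 1 else 0) = 4 := fun s hs => by
    rw [← (mem_indepSets.1 hs).1]
    simp
  rw [Finset.sum_congr rfl this, Finset.sum_const, smul_eq_mul, mul_comm]

theorem indepDeg_le_of_minimal (H : SimpleGraph V)
    (htri : ∀ x y z, H.Adj x y → H.Adj y z → H.Adj x z → False)
    (hmin : ∀ H' : SimpleGraph V, (∀ x y z, H'.Adj x y → H'.Adj y z → H'.Adj x z → False) →
      (indepSets H 4).card ≤ (indepSets H' 4).card) (u v : V) :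
    indepDeg H v ≤ indepDeg H u + Fintype.card V ^ 2 := by
  rcases eq_or_ne u v with rfl | huv
  · omega
  let φ : V → V := Function.update id v u
  have hφv : φ v = u := Function.update_self _ _ _
  have hφ : ∀ x, x ≠ v → φ x = x := fun x hx => Function.update_of_ne hx _ _
  have h := hmin (H.comap φ) fun x y z h1 h2 h3 => htri _ _ _ h1 h2 h3
  have hout : ((indepSets (H.comap φ) 4).filter fun s => v ∉ s).card ≤
      ((indepSets H 4).filter fun s => v ∉ s).card := by
    refine Finset.card_le_card fun s hs => ?_
    rw [Finset.mem_filter, mem_indepSets] at hs ⊢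
    obtain ⟨⟨hc, hi⟩, hv⟩ := hs
    refine ⟨⟨hc, fun x hx y hy hxy => hi x hx y hy ?_⟩, hv⟩
    rw [SimpleGraph.comap_adj, hφ x (ne_of_mem_of_not_mem hx hv),
      hφ y (ne_of_mem_of_not_mem hy hv)]
    exact hxy
  have hone : (((indepSets (H.comap φ) 4).filter fun s => v ∈ s).filter fun s => u ∉ s).card ≤
      indepDeg H u := by
    refine Finset.card_le_card_of_injOn (fun s => insert u (s.erase v)) ?_ ?_
    · intro s hs
      simp only [Finset.coe_filter, Finset.mem_filter, mem_indepSets, Set.mem_ofPred_eq] at hs ⊢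
      obtain ⟨⟨⟨hc, hi⟩, hv⟩, hu⟩ := hs
      have himg : insert u (s.erase v) = s.image φ := by
        rw [← Finset.insert_erase hv, Finset.image_insert, hφv]
        congr 1
        simp only [Finset.erase_insert_eq_erase, Finset.erase_idem]
        ext x
        simp only [Finset.mem_image]
        constructor
        · intro hx
          exact ⟨x, hx, hφ x (Finset.ne_of_mem_erase hx)⟩
        · rintro ⟨y, hy, rfl⟩
          rwa [hφ y (Finset.ne_of_mem_erase hy)]
      refine ⟨⟨?_, ?_⟩, Finset.mem_insert_self _ _⟩
      · rw [Finset.card_insert_of_notMem fun h => hu (Finset.mem_of_mem_erase h),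
          Finset.card_erase_of_mem hv, hc]
      · rw [himg]
        simp only [Finset.forall_mem_image]
        exact fun x hx y hy hxy => hi x hx y hy hxy
    · intro s hs t ht hst
      simp only [Finset.coe_filter, Finset.mem_filter, Set.mem_ofPred_eq] at hs ht
      simp only at hst
      have h1 : s.erase v = t.erase v := by
        rw [← Finset.erase_insert (a := u) (s := s.erase v)
          fun h => hs.2 (Finset.mem_of_mem_erase h), hst,
          Finset.erase_insert fun h => ht.2 (Finset.mem_of_mem_erase h)]
      rw [← Finset.insert_erase hs.1.2, h1, Finset.insert_erase ht.1.2]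
  have htwo : (((indepSets (H.comap φ) 4).filter fun s => v ∈ s).filter fun s => ¬ u ∉ s).card ≤
      Fintype.card V ^ 2 := by
    calc _ ≤ ((Finset.univ : Finset V).powersetCard 2).card := by
          refine Finset.card_le_card_of_injOn (fun s => (s.erase v).erase u) ?_ ?_
          · intro s hs
            simp only [Finset.coe_filter, Finset.mem_filter, mem_indepSets, Set.mem_ofPred_eq,
              not_not] at hs
            simp only [Finset.mem_coe, Finset.mem_powersetCard, Finset.subset_univ, true_and]
            rw [Finset.card_erase_of_mem (Finset.mem_erase.2 ⟨huv, hs.2⟩),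
              Finset.card_erase_of_mem hs.1.2, hs.1.1.1]
          · intro s hs t ht hst
            simp only [Finset.coe_filter, Finset.mem_filter, Set.mem_ofPred_eq, not_not] at hs ht
            simp only at hst
            rw [← Finset.insert_erase hs.1.2,
              ← Finset.insert_erase (Finset.mem_erase.2 ⟨huv, hs.2⟩), hst,
              Finset.insert_erase (Finset.mem_erase.2 ⟨huv, ht.2⟩), Finset.insert_erase ht.1.2]
      _ = (Fintype.card V).choose 2 := by rw [Finset.card_powersetCard, Finset.card_univ]
      _ ≤ _ := Nat.choose_le_pow _ _
  have e1 := Finset.card_filter_add_card_filter_not (s := indepSets H 4) (fun s => v ∈ s)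
  have e2 := Finset.card_filter_add_card_filter_not (s := indepSets (H.comap φ) 4) (fun s => v ∈ s)
  have e3 := Finset.card_filter_add_card_filter_not
    (s := (indepSets (H.comap φ) 4).filter fun s => v ∈ s) (fun s => u ∉ s)
  unfold indepDeg at *
  omega

theorem card_mul_indepDeg_le (H : SimpleGraph V)
    (htri : ∀ x y z, H.Adj x y → H.Adj y z → H.Adj x z → False)
    (hmin : ∀ H' : SimpleGraph V, (∀ x y z, H'.Adj x y → H'.Adj y z → H'.Adj x z → False) →
      (indepSets H 4).card ≤ (indepSets H' 4).card) (v : V) :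
    Fintype.card V * indepDeg H v ≤ 4 * (indepSets H 4).card + Fintype.card V ^ 3 := by
  have := Finset.sum_le_sum fun u (_ : u ∈ Finset.univ) => indepDeg_le_of_minimal H htri hmin u v
  rw [Finset.sum_add_distrib, sum_indepDeg] at this
  simp only [Finset.sum_const, Finset.card_univ, smul_eq_mul] at this
  linarith

theorem near_le_indepDeg (H : SimpleGraph V) (v : V) (S : Finset V) (f : V → Fin 5)
    (hv : ∀ x ∈ S, x ≠ v ∧ ¬ H.Adj v x)
    (hS : ∀ x ∈ S, ∀ y ∈ S, H.Adj x y → ∀ i, (f x = i ∨ f x = i + 1) → (f y = i ∨ f y = i + 1) →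
      False) :
    ∑ i, ((S.filter fun x => f x = i).card + (S.filter fun x => f x = i + 1).card).choose 3 ≤
      indepDeg H v + ∑ i, (S.filter fun x => f x = i).card.choose 3 := by
  rw [← card_near_sets _ _ (by norm_num)]
  gcongr
  refine Finset.card_le_card_of_injOn (fun s => insert v s) ?_ ?_
  · intro s hs
    simp only [Finset.coe_filter, Finset.mem_powersetCard, Set.mem_ofPred_eq] at hs
    obtain ⟨⟨hsub, hc⟩, i, hi⟩ := hs
    simp only [Finset.coe_filter, Set.mem_ofPred_eq, mem_indepSets]
    refine ⟨⟨?_, ?_⟩, Finset.mem_insert_self _ _⟩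
    · rw [Finset.card_insert_of_notMem fun h => (hv v (hsub h)).1 rfl, hc]
    · intro x hx y hy hxy
      rcases Finset.mem_insert.1 hx with rfl | hxs
      · rcases Finset.mem_insert.1 hy with rfl | hys
        · exact hxy.ne rfl
        · exact (hv y (hsub hys)).2 hxy
      · rcases Finset.mem_insert.1 hy with rfl | hys
        · exact (hv x (hsub hxs)).2 hxy.symm
        · exact hS x (hsub hxs) y (hsub hys) hxy i (hi x hxs) (hi y hys)
  · intro s hs t ht hst
    simp only [Finset.coe_filter, Finset.mem_powersetCard, Set.mem_ofPred_eq] at hs ht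
    simp only at hst
    rw [← Finset.erase_insert (a := v) (s := s) fun h => (hv v (hs.1.1 h)).1 rfl, hst,
      Finset.erase_insert fun h => (hv v (ht.1.1 h)).1 rfl]

end Cloning

theorem cubic_lower {a s t p q m : ℝ} (ha : 0 ≤ a) (hs : 0 ≤ s) (ht : 0 ≤ t) (hp : a ≤ p)
    (hq : a ≤ q) (hm : a ≤ m) :
    3 * a ^ 2 * (s + t) + 15 * a ^ 3 ≤
      (s + t) ^ 3 + (t + p) ^ 3 + (p + q) ^ 3 + (q + m) ^ 3 + (m + s) ^ 3 -
        (s ^ 3 + t ^ 3 + p ^ 3 + q ^ 3 + m ^ 3) := by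
  have hp0 := ha.trans hp
  have hq0 := ha.trans hq
  have hm0 := ha.trans hm
  have h1 : s ^ 3 + t ^ 3 ≤ (s + t) ^ 3 := by
    have : 0 ≤ 3 * (s * t * (s + t)) := by positivity
    linarith
  have h2 : ∀ p t : ℝ, a ≤ p → 0 ≤ t → p ^ 3 + 3 * a ^ 2 * t ≤ (t + p) ^ 3 := fun p t hp ht => by
    have e1 : a ^ 2 * t ≤ p ^ 2 * t := by gcongr
    have e2 : 0 ≤ t ^ 2 * (3 * p + t) := by
      have := ha.trans hp
      positivity
    linarith
  have h3 : (a + q) ^ 3 ≤ (p + q) ^ 3 := by gcongr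
  have h4 : (q + a) ^ 3 ≤ (q + m) ^ 3 := by gcongr
  have h5 : 15 * a ^ 3 ≤ 2 * (a + q) ^ 3 - q ^ 3 := by
    obtain ⟨d, hd, rfl⟩ : ∃ d, 0 ≤ d ∧ q = a + d := ⟨q - a, by linarith, by ring⟩
    have : 0 ≤ d ^ 3 + 9 * (a * d ^ 2) + 21 * (a ^ 2 * d) := by positivity
    linarith
  have h6 := h2 p t hp ht
  have h7 := h2 m s hm hs
  rw [add_comm s m] at h7
  linarith

theorem small_of_cubic {n e η s t p q m : ℝ} (hn : 0 < n) (he : 0 ≤ e) (he' : e ≤ 1 / 100)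
    (hs : 0 ≤ s) (ht : 0 ≤ t) (hp : (1 / 5 - e) * n ≤ p) (hq : (1 / 5 - e) * n ≤ q)
    (hm : (1 / 5 - e) * n ≤ m)
    (hΦ : (s + t) ^ 3 + (t + p) ^ 3 + (p + q) ^ 3 + (q + m) ^ 3 + (m + s) ^ 3 -
        (s ^ 3 + t ^ 3 + p ^ 3 + q ^ 3 + m ^ 3) ≤ (3 / 25 + η) * n ^ 3) :
    s + t ≤ (18 * e + 10 * η) * n := by
  have h := cubic_lower (by nlinarith) hs ht hp hq hm
  have h1 : (1 / 125 - 3 / 25 * e) * n ^ 3 ≤ ((1 / 5 - e) * n) ^ 3 := by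
    rw [mul_pow]
    gcongr
    nlinarith [mul_nonneg he he]
  have h2 : 1 / 30 * n ^ 2 * (s + t) ≤ ((1 / 5 - e) * n) ^ 2 * (s + t) := by
    rw [mul_pow]
    gcongr
    nlinarith
  have h3 : n ^ 2 * (s + t) ≤ n ^ 2 * ((18 * e + 10 * η) * n) := by linarith
  exact le_of_mul_le_mul_left h3 (by positivity)

theorem small_of_cyclic_cubic {n e η : ℝ} (x : Fin 5 → ℝ) (k : Fin 5) (hn : 0 < n) (he : 0 ≤ e)
    (he' : e ≤ 1 / 100) (hx : ∀ i, 0 ≤ x i)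
    (hlow : ∀ i, i ≠ k → i ≠ k + 1 → (1 / 5 - e) * n ≤ x i)
    (hΦ : ∑ i, (x i + x (i + 1)) ^ 3 - ∑ i, x i ^ 3 ≤ (3 / 25 + η) * n ^ 3) :
    x k + x (k + 1) ≤ (18 * e + 10 * η) * n := by
  have hne : ∀ k : Fin 5, (k + 2 ≠ k ∧ k + 2 ≠ k + 1) ∧ (k + 3 ≠ k ∧ k + 3 ≠ k + 1) ∧
    (k + 4 ≠ k ∧ k + 4 ≠ k + 1) ∧ k + 1 + 1 = k + 2 ∧ k + 2 + 1 = k + 3 ∧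
      k + 3 + 1 = k + 4 ∧ k + 4 + 1 = k ∧ k + 0 = k := by decide
  obtain ⟨h2, h3, h4, e1, e2, e3, e4, e5⟩ := hne k
  rw [← Equiv.sum_comp (Equiv.addLeft k), ← Equiv.sum_comp (Equiv.addLeft k) fun i => x i ^ 3,
    Fin.sum_univ_five, Fin.sum_univ_five] at hΦ
  simp only [Equiv.coe_addLeft, e1, e2, e3, e4, e5] at hΦ
  exact small_of_cubic hn he he' (hx _) (hx _) (hlow _ h2.1 h2.2) (hlow _ h3.1 h3.2)
    (hlow _ h4.1 h4.2) hΦ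

section Structure

variable {V : Type*}

open Classical in
/-- The vertices of `U` in class `i` that are not adjacent to `v`. -/
noncomputable def missing (H : SimpleGraph V) (U : Finset V) (f : V → Fin 5) (v : V) (i : Fin 5) :
    Finset V :=
  U.filter fun x => f x = i ∧ ¬ H.Adj v x

open Classical in
/-- The neighbours of `v` in `U` of class `i`. -/
noncomputable def hitting (H : SimpleGraph V) (U : Finset V) (f : V → Fin 5) (v : V) (i : Fin 5) :
    Finset V :=
  U.filter fun x => f x = i ∧ H.Adj v x

theorem card_hitting_add_card_missing (H : SimpleGraph V) (U : Finset V) (f : V → Fin 5) (v : V)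
    (i : Fin 5) : (hitting H U f v i).card + (missing H U f v i).card =
      (U.filter fun x => f x = i).card := by
  classical
  rw [hitting, missing, ← Finset.filter_filter, ← Finset.filter_filter,
    Finset.card_filter_add_card_filter_not]

variable [Fintype V] [DecidableEq V]

theorem card_missing_le (H : SimpleGraph V)
    (U : Finset V) (f : V → Fin 5) (hn : 1000000000000 ≤ Fintype.card V)
    (hU : ∀ x ∈ U, ∀ y ∈ U, H.Adj x y → f y = f x + 2 ∨ f x = f y + 2)
    (hA : ∀ i, (1 / 5 - 1 / 5000000) * (Fintype.card V : ℝ) ≤ (U.filter fun x => f x = i).card)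
    (hdeg : ∀ v, 150 * indepDeg H v ≤ 3 * Fintype.card V ^ 3 + 500 * Fintype.card V ^ 2)
    (v : V) (k : Fin 5) {τ : ℝ} (hτ : 0 ≤ τ) (hτ' : τ ≤ 1 / 1000)
    (hk : ∀ i, i ≠ k → i ≠ k + 1 → ((hitting H U f v i).card : ℝ) ≤ τ * Fintype.card V) :
    ((missing H U f v k).card : ℝ) + (missing H U f v (k + 1)).card ≤
      (20 * τ + 1 / 100000) * Fintype.card V := by
  classical
  set n : ℝ := (Fintype.card V : ℝ) with hndef
  have hn' : (1000000000000 : ℝ) ≤ n := by rw [hndef]; exact_mod_cast hn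
  let S := U.filter fun x => ¬ H.Adj v x ∧ x ≠ v
  let x : Fin 5 → ℕ := fun i => (S.filter fun x => f x = i).card
  have hfar : ∀ i a b : Fin 5, b = a + 2 ∨ a = b + 2 → a = i ∨ a = i + 1 → b = i ∨ b = i + 1 →
      False := by decide
  have hnear := near_le_indepDeg H v S f (fun y hy => by
      have := (Finset.mem_filter.1 hy).2
      exact ⟨this.2, this.1⟩) fun y hy z hz hyz i h1 h2 =>
        hfar i _ _ (hU y (Finset.mem_filter.1 hy).1 z (Finset.mem_filter.1 hz).1 hyz) h1 h2
  change ∑ i, (x i + x (i + 1)).choose 3 ≤ _ + ∑ i, (x i).choose 3 at hnear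
  have hmx : ∀ i, (missing H U f v i).card ≤ x i + 1 := fun i => by
    refine le_trans (Finset.card_le_card ?_) (Finset.card_insert_le v _)
    intro y hy
    simp only [missing, Finset.mem_filter, Finset.mem_insert, S] at hy ⊢
    tauto
  have hxn : ∀ i, x i + x (i + 1) ≤ Fintype.card V := fun i => by
    have hd : Disjoint (S.filter fun x => f x = i) (S.filter fun x => f x = i + 1) := by
      refine Finset.disjoint_filter.2 fun x _ h h' => ?_
      rw [h] at h'
      have : ∀ i : Fin 5, i ≠ i + 1 := by decide
      exact this i h'
    rw [← Finset.card_union_of_disjoint hd]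
    exact Finset.card_le_univ _
  have h3 : ∀ m : ℕ, (6 : ℝ) * (m.choose 3 : ℝ) = m ^ 3 - 3 * m ^ 2 + 2 * m := fun m => by
    have := cast_choose_three m
    have h : (6 : ℝ) * (m.choose 3 : ℝ) = m * (m - 1) * (m - 2) := by exact_mod_cast this
    rw [h]
    ring
  have hsum1 : ∑ i, ((x i : ℝ) + x (i + 1)) ^ 3 - 15 * n ^ 2 ≤
      6 * ∑ i, ((x i + x (i + 1)).choose 3 : ℝ) := by
    have : ∀ i, ((x i : ℝ) + x (i + 1)) ^ 3 - 3 * n ^ 2 ≤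
        6 * ((x i + x (i + 1)).choose 3 : ℝ) := fun i => by
      rw [h3]
      have h : ((x i + x (i + 1) : ℕ) : ℝ) ≤ n := by
        rw [hndef]
        exact_mod_cast hxn i
      have h' : ((x i + x (i + 1) : ℕ) : ℝ) ^ 2 ≤ n ^ 2 := by gcongr
      have h0 : (0 : ℝ) ≤ ((x i + x (i + 1) : ℕ) : ℝ) := by positivity
      push_cast at *
      linarith
    have h := Finset.sum_le_sum fun i (_ : i ∈ Finset.univ) => this i
    rw [Finset.sum_sub_distrib, ← Finset.mul_sum] at h
    simp only [Finset.sum_const, Finset.card_univ, Fintype.card_fin, nsmul_eq_mul] at h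
    push_cast at h
    rw [← Finset.mul_sum] at h
    linarith
  have hsum2 : 6 * ∑ i, ((x i).choose 3 : ℝ) ≤ ∑ i, (x i : ℝ) ^ 3 := by
    rw [Finset.mul_sum]
    refine Finset.sum_le_sum fun i _ => ?_
    rw [h3]
    rcases Nat.eq_zero_or_pos (x i) with h | h
    · simp [h]
    · have h1 : (1 : ℝ) ≤ x i := by exact_mod_cast h
      nlinarith
  have hd : 150 * (indepDeg H v : ℝ) ≤ 3 * n ^ 3 + 500 * n ^ 2 := by
    rw [hndef]
    exact_mod_cast hdeg v
  have hnear' : ∑ i, ((x i + x (i + 1)).choose 3 : ℝ) ≤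
      (indepDeg H v : ℝ) + ∑ i, ((x i).choose 3 : ℝ) := by exact_mod_cast hnear
  have hΦ : ∑ i, ((x i : ℝ) + x (i + 1)) ^ 3 - ∑ i, (x i : ℝ) ^ 3 ≤
      (3 / 25 + 1 / 10000000) * n ^ 3 := by
    have : 10000000 * (35 * n ^ 2) ≤ n ^ 3 := by
      have := mul_le_mul_of_nonneg_right hn' (sq_nonneg n)
      nlinarith [sq_nonneg n]
    linarith
  have hlow : ∀ i, i ≠ k → i ≠ k + 1 → (1 / 5 - (τ + 1 / 4000000)) * n ≤ x i := fun i h1 h2 => by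
    have e1 := hk i h1 h2
    have e2 := hA i
    have e3 : ((hitting H U f v i).card : ℝ) + (missing H U f v i).card =
      (U.filter fun x => f x = i).card := by exact_mod_cast card_hitting_add_card_missing H U f v i
    have e4 : ((missing H U f v i).card : ℝ) ≤ x i + 1 := by exact_mod_cast hmx i
    nlinarith
  have hfin := small_of_cyclic_cubic (fun i => (x i : ℝ)) k (by linarith)
    (by linarith : 0 ≤ τ + 1 / 4000000) (by linarith) (fun i => by positivity) hlow hΦ
  have m1 : ((missing H U f v k).card : ℝ) ≤ x k + 1 := by exact_mod_cast hmx k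
  have m2 : ((missing H U f v (k + 1)).card : ℝ) ≤ x (k + 1) + 1 := by exact_mod_cast hmx (k + 1)
  have hτn : 0 ≤ τ * n := by positivity
  linarith

theorem exists_class (H : SimpleGraph V)
    (htri : ∀ x y z, H.Adj x y → H.Adj y z → H.Adj x z → False)
    (U : Finset V) (f : V → Fin 5) (hn : 1000000000000 ≤ Fintype.card V)
    (hU : ∀ x ∈ U, ∀ y ∈ U, H.Adj x y → f y = f x + 2 ∨ f x = f y + 2)
    (hA : ∀ i, (1 / 5 - 1 / 5000000) * (Fintype.card V : ℝ) ≤ (U.filter fun x => f x = i).card)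
    (hdeg : ∀ v, 150 * indepDeg H v ≤ 3 * Fintype.card V ^ 3 + 500 * Fintype.card V ^ 2)
    (v : V) : ∃ j, (v ∈ U → j = f v) ∧
      ((missing H U f v (j + 2)).card : ℝ) ≤ 1 / 1000 * Fintype.card V ∧
      ((missing H U f v (j + 3)).card : ℝ) ≤ 1 / 1000 * Fintype.card V := by
  classical
  have hadd : ∀ j : Fin 5, j + 2 + 1 = j + 3 := by decide
  have hn0 : (0 : ℝ) ≤ Fintype.card V := by positivity
  have hgood : ∀ u ∈ U, ((missing H U f u (f u + 2)).card : ℝ) +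
      (missing H U f u (f u + 3)).card ≤ 1 / 100000 * Fintype.card V := fun u hu => by
    have := card_missing_le H U f hn hU hA hdeg u (f u + 2) le_rfl (by norm_num)
      fun i h1 h2 => by
        rw [zero_mul]
        have : hitting H U f u i = ∅ := by
          refine Finset.filter_eq_empty_iff.2 fun x hx h => ?_
          have h3 := hU u hu x hx h.2
          rw [h.1] at h3
          have : ∀ i j : Fin 5, i ≠ j + 2 → i ≠ j + 2 + 1 → ¬ (i = j + 2 ∨ j = i + 2) := by decide
          exact this i _ h1 h2 h3
        simp [this]
    rw [hadd] at this
    linarith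
  by_cases hv : v ∈ U
  · have := hgood v hv
    have h1 : (0 : ℝ) ≤ (missing H U f v (f v + 2)).card := by positivity
    have h2 : (0 : ℝ) ≤ (missing H U f v (f v + 3)).card := by positivity
    exact ⟨f v, fun _ => rfl, by linarith, by linarith⟩
  · obtain ⟨k, hk⟩ := near_of_pairwise
      (Finset.univ.filter fun i => 1 / 100000 * (Fintype.card V : ℝ) < (hitting H U f v i).card) (by
        intro i hi i' hi' hii
        subst hii
        simp only [Finset.mem_filter, Finset.mem_univ, true_and] at hi hi'
        have hpos : 0 < (hitting H U f v i).card := by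
          have : (0 : ℝ) < (hitting H U f v i).card := lt_of_le_of_lt (by positivity) hi
          exact_mod_cast this
        obtain ⟨u, hu⟩ := Finset.card_pos.1 hpos
        obtain ⟨huU, hui, hvu⟩ := Finset.mem_filter.1 hu
        have hsub : hitting H U f v (i + 2) ⊆ missing H U f u (f u + 2) := fun y hy => by
          obtain ⟨hyU, hyi, hvy⟩ := Finset.mem_filter.1 hy
          refine Finset.mem_filter.2 ⟨hyU, by rw [hyi, hui], fun huy => htri v u y hvu huy hvy⟩
        have h1 : ((hitting H U f v (i + 2)).card : ℝ) ≤ (missing H U f u (f u + 2)).card := by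
          exact_mod_cast Finset.card_le_card hsub
        have h2 := hgood u huU
        have h3 : (0 : ℝ) ≤ (missing H U f u (f u + 3)).card := by positivity
        linarith)
    have := card_missing_le H U f hn hU hA hdeg v k (τ := 1 / 100000) (by norm_num) (by norm_num)
      fun i h1 h2 => by
        by_contra! hcon
        exact (hk i (Finset.mem_filter.2 ⟨Finset.mem_univ _, hcon⟩)).elim h1 h2
    have h1 : (0 : ℝ) ≤ (missing H U f v k).card := by positivity
    have h2 : (0 : ℝ) ≤ (missing H U f v (k + 1)).card := by positivity
    have e : ∀ k : Fin 5, k + 3 + 2 = k ∧ k + 3 + 3 = k + 1 := by decide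
    refine ⟨k + 3, fun h => absurd h hv, ?_, ?_⟩
    · rw [(e k).1]
      linarith
    · rw [(e k).2]
      linarith

/-- An approximate blow-up structure on almost all vertices extends to an exact one. -/
theorem exists_far_classes (H : SimpleGraph V)
    (htri : ∀ x y z, H.Adj x y → H.Adj y z → H.Adj x z → False)
    (U : Finset V) (f : V → Fin 5) (hn : 1000000000000 ≤ Fintype.card V)
    (hU : ∀ x ∈ U, ∀ y ∈ U, H.Adj x y → f y = f x + 2 ∨ f x = f y + 2)
    (hA : ∀ i, (1 / 5 - 1 / 5000000) * (Fintype.card V : ℝ) ≤ (U.filter fun x => f x = i).card)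
    (hdeg : ∀ v, 150 * indepDeg H v ≤ 3 * Fintype.card V ^ 3 + 500 * Fintype.card V ^ 2) :
    ∃ g : V → Fin 5, (∀ x y, H.Adj x y → g y = g x + 2 ∨ g x = g y + 2) ∧
      ∀ i, (1 / 5 - 1 / 5000000) * (Fintype.card V : ℝ) ≤
        (Finset.univ.filter fun x => g x = i).card := by
  classical
  choose g hgU hg2 hg3 using exists_class H htri U f hn hU hA hdeg
  refine ⟨g, fun x y hxy => ?_, fun i => (hA i).trans ?_⟩
  · by_contra hcon
    have hm : ∀ a b : Fin 5, ¬ (b = a + 2 ∨ a = b + 2) →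
        ∃ m, (m = a + 2 ∨ m = a + 3) ∧ (m = b + 2 ∨ m = b + 3) := by decide
    obtain ⟨m, hmx, hmy⟩ := hm _ _ hcon
    have hx : ((missing H U f x m).card : ℝ) ≤ 1 / 1000 * Fintype.card V := by
      rcases hmx with rfl | rfl
      exacts [hg2 x, hg3 x]
    have hy : ((missing H U f y m).card : ℝ) ≤ 1 / 1000 * Fintype.card V := by
      rcases hmy with h | h <;> rw [h]
      exacts [hg2 y, hg3 y]
    have hsub : (U.filter fun x => f x = m) ⊆ missing H U f x m ∪ missing H U f y m := by
      intro z hz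
      obtain ⟨hzU, hzm⟩ := Finset.mem_filter.1 hz
      by_contra hz'
      simp only [Finset.mem_union, missing, Finset.mem_filter, hzU, hzm, true_and, not_or,
        not_not] at hz'
      exact htri x y z hxy hz'.2 hz'.1
    have hc : ((U.filter fun x => f x = m).card : ℝ) ≤
        (missing H U f x m).card + (missing H U f y m).card := by
      exact_mod_cast (Finset.card_le_card hsub).trans (Finset.card_union_le _ _)
    have := hA m
    have hn' : (1000000000000 : ℝ) ≤ Fintype.card V := by exact_mod_cast hn
    linarith
  · have : (U.filter fun x => f x = i) ⊆ Finset.univ.filter fun x => g x = i := fun x hx => by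
      obtain ⟨hxU, hxi⟩ := Finset.mem_filter.1 hx
      exact Finset.mem_filter.2 ⟨Finset.mem_univ _, (hgU x hxU).trans hxi⟩
    exact_mod_cast Finset.card_le_card this

end Structure

section Assembly

/-- A 5-cycle `c i, c (i + 2)` in a triangle-free graph splits the vertices having two neighbours
on it into classes such that edges join far classes. -/
theorem exists_classes_of_cycle {V : Type*} (H : SimpleGraph V)
    (htri : ∀ x y z, H.Adj x y → H.Adj y z → H.Adj x z → False) (c : Fin 5 → V) :
    ∃ f : V → Fin 5, ∀ x, (∃ i, H.Adj (c (i + 2)) x ∧ H.Adj (c (i + 3)) x) →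
      (H.Adj (c (f x + 2)) x ∧ H.Adj (c (f x + 3)) x) ∧
      ∀ y, (∃ i, H.Adj (c (i + 2)) y ∧ H.Adj (c (i + 3)) y) → H.Adj x y →
        f y = f x + 2 ∨ f x = f y + 2 := by
  classical
  let f : V → Fin 5 := fun x =>
    if h : ∃ i, H.Adj (c (i + 2)) x ∧ H.Adj (c (i + 3)) x then h.choose else 0
  have hf : ∀ x, (∃ i, H.Adj (c (i + 2)) x ∧ H.Adj (c (i + 3)) x) →
      H.Adj (c (f x + 2)) x ∧ H.Adj (c (f x + 3)) x := fun x h => by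
    simp only [f, dif_pos h]
    exact h.choose_spec
  have hcommon : ∀ i j : Fin 5, (j = i + 2 ∨ i = j + 2) ∨
      ∃ m, (m = i + 2 ∨ m = i + 3) ∧ (m = j + 2 ∨ m = j + 3) := by decide
  refine ⟨f, fun x hx => ⟨hf x hx, fun y hy hxy => ?_⟩⟩
  refine (hcommon (f x) (f y)).resolve_right ?_
  rintro ⟨m, hmx, hmy⟩
  have h1 : H.Adj (c m) x := by
    rcases hmx with rfl | rfl
    exacts [(hf x hx).1, (hf x hx).2]
  have h2 : H.Adj (c m) y := by
    rcases hmy with rfl | rfl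
    exacts [(hf y hy).1, (hf y hy).2]
  exact htri _ _ _ h1 hxy h2

variable {V : Type*} [Fintype V] [DecidableEq V]

theorem class_size_of_degrees {n : ℝ} (hn : 0 ≤ n) (a : Fin 5 → ℝ) (u : ℝ)
    (hu : u ≤ n / 10000000) (hsum : a 0 + a 1 + a 2 + a 3 + a 4 + u = n)
    (hd : ∀ k, 5 * (a (k + 2) + a (k + 3)) ≤ (2 + 1 / 10000000) * n) (i : Fin 5) :
    (1 / 5 - 1 / 5000000) * n ≤ a i := by
  have h0 : 5 * (a 2 + a 3) ≤ (2 + 1 / 10000000) * n := hd 0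
  have h1 : 5 * (a 3 + a 4) ≤ (2 + 1 / 10000000) * n := hd 1
  have h2 : 5 * (a 4 + a 0) ≤ (2 + 1 / 10000000) * n := hd 2
  have h3 : 5 * (a 0 + a 1) ≤ (2 + 1 / 10000000) * n := hd 3
  have h4 : 5 * (a 1 + a 2) ≤ (2 + 1 / 10000000) * n := hd 4
  match i with
  | 0 => linarith
  | 1 => linarith
  | 2 => linarith
  | 3 => linarith
  | 4 => linarith

theorem exists_large_classes (H : SimpleGraph V)
    (htri : ∀ x y z, H.Adj x y → H.Adj y z → H.Adj x z → False)
    (hn : 10 ^ 30 ≤ Fintype.card V)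
    (hI : 600 * ((indepSets H 4).card : ℤ) ≤
      3 * (Fintype.card V : ℤ) ^ 4 + 300 * (Fintype.card V : ℤ) ^ 3) :
    ∃ (U : Finset V) (f : V → Fin 5),
      (∀ x ∈ U, ∀ y ∈ U, H.Adj x y → f y = f x + 2 ∨ f x = f y + 2) ∧
      ∀ i, (1 / 5 - 1 / 5000000) * (Fintype.card V : ℝ) ≤ (U.filter fun x => f x = i).card := by
  classical
  have hn' : (10 : ℤ) ^ 30 ≤ Fintype.card V := by exact_mod_cast hn
  obtain ⟨v₀, v₁, v₂, v₃, v₄, hcyc, hle⟩ := FlagCert.Pattern.exists_good_cycle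
    (r := fun x y => decide (H.Adj x y)) (fun x y => by simp only [H.adj_comm x y])
    (fun x y z h1 h2 h3 => htri x y z (by simpa using h1) (by simpa using h2) (by simpa using h3))
    (le_trans (by norm_num) hn) (by
      have := indepTuples_le H
      have h3 : 0 ≤ (Fintype.card V : ℤ) ^ 3 := by positivity
      linarith)
  set r : V → V → Bool := fun x y => decide (H.Adj x y)
  let c : Fin 5 → V := ![v₀, v₃, v₁, v₄, v₂]
  obtain ⟨f, hf⟩ := exists_classes_of_cycle H htri c
  let U : Finset V := Finset.univ.filter fun x => ∃ i, H.Adj (c (i + 2)) x ∧ H.Adj (c (i + 3)) x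
  have hU : ∀ x, x ∈ U ↔ ∃ i, H.Adj (c (i + 2)) x ∧ H.Adj (c (i + 3)) x := by simp [U]
  have hdev : ∀ i, 0 ≤ FlagCert.Pattern.devSq r i := fun i => sq_nonneg _
  have hbad : ((Uᶜ.card : ℕ) : ℤ) ≤ FlagCert.Pattern.badCount r v₀ v₁ v₂ v₃ v₄ := by
    rw [Finset.card_eq_sum_ones, Nat.cast_sum, FlagCert.Pattern.badCount]
    refine (Finset.sum_le_sum fun x hx => ?_).trans
      (Finset.sum_le_sum_of_subset_of_nonneg (Finset.subset_univ _) fun x _ _ => ?_)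
    · rw [Finset.mem_compl, hU, not_exists] at hx
      have x0 : ¬ (H.Adj v₁ x ∧ H.Adj v₄ x) := hx 0
      have x1 : ¬ (H.Adj v₄ x ∧ H.Adj v₂ x) := hx 1
      have x2 : ¬ (H.Adj v₂ x ∧ H.Adj v₀ x) := hx 2
      have x3 : ¬ (H.Adj v₀ x ∧ H.Adj v₃ x) := hx 3
      have x4 : ¬ (H.Adj v₃ x ∧ H.Adj v₁ x) := hx 4
      rw [FlagCert.Pattern.badFor, Bool.cond_eq_ite, if_neg]
      · simp
      · simp only [r, Bool.or_eq_true, Bool.and_eq_true, decide_eq_true_eq]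
        tauto
    · rw [FlagCert.Pattern.badFor, Bool.cond_eq_ite]
      split_ifs <;> simp
  have hdeg : ∀ k, (((U.filter fun x => f x = k + 2).card + (U.filter fun x => f x = k + 3).card :
      ℕ) : ℤ) ≤ FlagCert.Pattern.deg r (c k) := fun k => by
    have hd : Disjoint (U.filter fun x => f x = k + 2) (U.filter fun x => f x = k + 3) := by
      refine Finset.disjoint_filter.2 fun x _ h h' => ?_
      rw [h] at h'
      have : ∀ i : Fin 5, i + 2 ≠ i + 3 := by decide
      exact this k h'
    have hk : ∀ k : Fin 5, k + 2 + 3 = k ∧ k + 3 + 2 = k := by decide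
    rw [← Finset.card_union_of_disjoint hd, FlagCert.Pattern.deg]
    simp only [Bool.cond_eq_ite, r, decide_eq_true_eq]
    rw [← Finset.natCast_card_filter]
    refine Nat.cast_le.2 (Finset.card_le_card fun x hx => ?_)
    simp only [Finset.mem_union, Finset.mem_filter, hU] at hx
    rw [Finset.mem_filter]
    refine ⟨Finset.mem_univ _, ?_⟩
    rcases hx with ⟨h1, h2⟩ | ⟨h1, h2⟩
    · have := (hf x h1).1.2
      rwa [h2, (hk k).1] at this
    · have := (hf x h1).1.1
      rwa [h2, (hk k).2] at this
  have hcard : (∑ i, (U.filter fun x => f x = i).card) + Uᶜ.card = Fintype.card V := by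
    rw [← Finset.card_eq_sum_card_fiberwise (fun x _ => Finset.mem_coe.2 (Finset.mem_univ _)),
      Finset.card_add_card_compl]
  have hb0 : 0 ≤ FlagCert.Pattern.badCount r v₀ v₁ v₂ v₃ v₄ := le_trans (by positivity) hbad
  refine ⟨U, f, fun x hx y hy => (hf x ((hU x).1 hx)).2 y ((hU y).1 hy), ?_⟩
  have hsmall : ∀ t : ℤ, (5 * t - 2 * Fintype.card V) ^ 2 ≤ 1000000000 * Fintype.card V →
      5 * 10000000 * t ≤ 20000001 * Fintype.card V := fun t ht => by
    by_contra! hlt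
    have h1 : (Fintype.card V : ℤ) ≤ 10000000 * (5 * t - 2 * Fintype.card V) := by linarith
    have h2 := pow_le_pow_left₀ (by positivity) h1 2
    have h3 := mul_le_mul_of_nonneg_right hn' (by positivity : (0 : ℤ) ≤ Fintype.card V)
    have h4 : (0 : ℤ) < Fintype.card V := by linarith
    nlinarith
  have hnb : (Fintype.card V : ℤ) * FlagCert.Pattern.badCount r v₀ v₁ v₂ v₃ v₄ ≤
      Fintype.card V * 1000000000 := by
    linarith [hdev v₀, hdev v₁, hdev v₂, hdev v₃, hdev v₄]
  have hbc := le_of_mul_le_mul_left hnb (by linarith)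
  have hnb0 := mul_nonneg (by positivity : (0 : ℤ) ≤ Fintype.card V) hb0
  have hdegs : ∀ k, 5 * 10000000 * FlagCert.Pattern.deg r (c k) ≤ 20000001 * Fintype.card V :=
    fun k => by
      refine hsmall _ ?_
      change FlagCert.Pattern.devSq r (c k) ≤ _
      match k with
      | 0 => change FlagCert.Pattern.devSq r v₀ ≤ _
             linarith [hdev v₀, hdev v₁, hdev v₂, hdev v₃, hdev v₄]
      | 1 => change FlagCert.Pattern.devSq r v₃ ≤ _
             linarith [hdev v₀, hdev v₁, hdev v₂, hdev v₃, hdev v₄]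
      | 2 => change FlagCert.Pattern.devSq r v₁ ≤ _
             linarith [hdev v₀, hdev v₁, hdev v₂, hdev v₃, hdev v₄]
      | 3 => change FlagCert.Pattern.devSq r v₄ ≤ _
             linarith [hdev v₀, hdev v₁, hdev v₂, hdev v₃, hdev v₄]
      | 4 => change FlagCert.Pattern.devSq r v₂ ≤ _
             linarith [hdev v₀, hdev v₁, hdev v₂, hdev v₃, hdev v₄]
  refine class_size_of_degrees (by positivity)
    (fun i => ((U.filter fun x => f x = i).card : ℝ)) (Uᶜ.card : ℝ) ?_ ?_ fun k => ?_
  · have h : 10000000 * ((Uᶜ.card : ℕ) : ℤ) ≤ Fintype.card V := by linarith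
    have h' : 10000000 * (Uᶜ.card : ℝ) ≤ Fintype.card V := by exact_mod_cast h
    linarith
  · rw [Fin.sum_univ_five] at hcard
    exact_mod_cast hcard
  · have h : 10000000 * (5 * (((U.filter fun x => f x = k + 2).card +
        (U.filter fun x => f x = k + 3).card : ℕ) : ℤ)) ≤ 20000001 * (Fintype.card V : ℤ) := by
      linarith [hdeg k, hdegs k]
    have h' : 10000000 * (5 * (((U.filter fun x => f x = k + 2).card : ℝ) +
        (U.filter fun x => f x = k + 3).card)) ≤ 20000001 * (Fintype.card V : ℝ) := by
      exact_mod_cast h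
    linarith

theorem extremalValue_le_of_classes (H : SimpleGraph V) (hn : 10000000 ≤ Fintype.card V)
    (g : V → Fin 5) (hg : ∀ x y, H.Adj x y → g y = g x + 2 ∨ g x = g y + 2)
    (hsize : ∀ i, (1 / 5 - 1 / 5000000) * (Fintype.card V : ℝ) ≤
      (Finset.univ.filter fun x => g x = i).card) :
    extremalValue (Fintype.card V) ≤ (indepSets H 4).card := by
  let b : Fin 5 → ℕ := fun i => (Finset.univ.filter fun x => g x = i).card
  have hb : ∑ i, b i = Fintype.card V :=
    (Finset.card_eq_sum_card_fiberwise fun x _ => Finset.mem_coe.2 (Finset.mem_univ _)).symm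
  rw [Fin.sum_univ_five] at hb
  have hlow : ∀ i, 999999 * Fintype.card V ≤ 5000000 * b i := fun i => by
    have h : 999999 * (Fintype.card V : ℝ) ≤ 5000000 * (b i : ℝ) := by linarith [hsize i]
    exact_mod_cast h
  have hclose : ∀ i, 1000 * |(b i : ℤ) - (Fintype.card V / 5 : ℕ)| ≤ (Fintype.card V / 5 : ℕ) := by
    have h0 := hlow 0
    have h1 := hlow 1
    have h2 := hlow 2
    have h3 := hlow 3
    have h4 := hlow 4
    intro i
    have habs : ∀ t m : ℤ, 1000 * t ≤ m → -m ≤ 1000 * t → 1000 * |t| ≤ m := fun t m h h' => by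
      rcases abs_cases t with ⟨h, _⟩ | ⟨h, _⟩ <;> rw [h] <;> linarith
    match i with
    | 0 => exact habs _ _ (by omega) (by omega)
    | 1 => exact habs _ _ (by omega) (by omega)
    | 2 => exact habs _ _ (by omega) (by omega)
    | 3 => exact habs _ _ (by omega) (by omega)
    | 4 => exact habs _ _ (by omega) (by omega)
  have h1 := blowupCount_bPart_le _ hn b hb hclose
  rw [blowupCount_bPart, blowupCount_cast] at h1
  have h2 : ∑ i, (b i + b (i + 1)).choose 4 ≤ (indepSets H 4).card + ∑ i, (b i).choose 4 :=
    blowup_le_card_indepSets H g hg (by norm_num)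
  omega

theorem extremalValue_le_of_minimal (H : SimpleGraph V) (hn : 10 ^ 30 ≤ Fintype.card V)
    (htri : ∀ x y z, H.Adj x y → H.Adj y z → H.Adj x z → False)
    (hmin : ∀ H' : SimpleGraph V, (∀ x y z, H'.Adj x y → H'.Adj y z → H'.Adj x z → False) →
      (indepSets H 4).card ≤ (indepSets H' 4).card)
    (hext : (indepSets H 4).card ≤ extremalValue (Fintype.card V)) :
    extremalValue (Fintype.card V) ≤ (indepSets H 4).card := by
  have hupper := blowupCount_bPart_upper (Fintype.card V) (le_trans (by norm_num) hn)
  rw [blowupCount_bPart] at hupper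
  have hext' : ((indepSets H 4).card : ℤ) ≤ extremalValue (Fintype.card V) := by
    exact_mod_cast hext
  have hI : 600 * ((indepSets H 4).card : ℤ) ≤
      3 * (Fintype.card V : ℤ) ^ 4 + 300 * (Fintype.card V : ℤ) ^ 3 := by linarith
  obtain ⟨U, f, hU, hA⟩ := exists_large_classes H htri hn hI
  have hdeg : ∀ v, 150 * indepDeg H v ≤ 3 * Fintype.card V ^ 3 + 500 * Fintype.card V ^ 2 := by
    intro v
    have h1 := card_mul_indepDeg_le H htri hmin v
    have h2 : 600 * (indepSets H 4).card ≤ 3 * Fintype.card V ^ 4 + 300 * Fintype.card V ^ 3 := by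
      exact_mod_cast hI
    have h3 : Fintype.card V * (150 * indepDeg H v) ≤
        Fintype.card V * (3 * Fintype.card V ^ 3 + 500 * Fintype.card V ^ 2) := by
      nlinarith [Nat.zero_le (Fintype.card V ^ 3)]
    exact le_of_mul_le_mul_left h3 (lt_of_lt_of_le (by norm_num) hn)
  obtain ⟨g, hg, hsize⟩ := exists_far_classes H htri U f (le_trans (by norm_num) hn) hU hA hdeg
  exact extremalValue_le_of_classes H (le_trans (by norm_num) hn) g hg hsize

end Assembly

/-- For all large n, f(n,4,3) = Σᵢ C(bᵢ + bᵢ₊₁, 4) − Σᵢ C(bᵢ, 4), indices mod 5. -/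
theorem erdos_43_exact_value :
    ∃ n₀ : ℕ, ∀ n : ℕ, n₀ ≤ n →
      minCliques n 4 3 =
        (∑ i : Fin 5, (bPart n i + bPart n (i + 1)).choose 4)
          - ∑ i : Fin 5, (bPart n i).choose 4 := by
  refine ⟨10 ^ 30, fun n hn => ?_⟩
  change _ = extremalValue n
  obtain ⟨H₀, htri₀, hH₀⟩ := exists_extremal_graph n (le_trans (by norm_num) hn)
  have hmem : ∀ H : SimpleGraph (Fin n), (∀ x y z, H.Adj x y → H.Adj y z → H.Adj x z → False) →
      (indepSets H 4).card ∈
        {m | ∃ G : SimpleGraph (Fin n), IndepBound G (3 - 1) ∧ cliqueCount G 4 = m} :=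
    fun H hH => ⟨Hᶜ, (indepBound_compl H).2 hH, cliqueCount_compl H 4⟩
  obtain ⟨G, hG, hGm⟩ := Nat.sInf_mem ⟨_, hmem H₀ htri₀⟩
  change _ = minCliques n 4 3 at hGm
  rw [← compl_compl G] at hG hGm
  have htri := (indepBound_compl Gᶜ).1 hG
  rw [cliqueCount_compl] at hGm
  have hmin : ∀ H : SimpleGraph (Fin n), (∀ x y z, H.Adj x y → H.Adj y z → H.Adj x z → False) →
      (indepSets Gᶜ 4).card ≤ (indepSets H 4).card := fun H hH =>
    hGm.le.trans (Nat.sInf_le (hmem H hH))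
  have hext : (indepSets Gᶜ 4).card ≤ extremalValue n := hH₀ ▸ hmin H₀ htri₀
  have hlow := extremalValue_le_of_minimal Gᶜ (by simpa using hn) htri hmin (by simpa using hext)
  rw [Fintype.card_fin] at hlow
  rw [← hGm]
  exact le_antisymm hext hlow
end
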